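/- arXiv:2310.01868 — 5 statements merged into one kernel-verified Lean document; each statement's English description precedes it below -/
import Mathlib

section
/- For every p ∈ [1,∞), α ∈ (0,1), q ∈ [2,∞) and C_q ∈ (0,∞) there exists a constant K ∈ (0,∞), depending only on p, α, q, C_q, such that for every real normed space X having cotype q with constant C_q, every n ∈ ℕ, and every function f : {-1,1}^n → X: ‖f − ∫_{{-1,1}^n} f dμ_α^n‖_{L_p(log L)^{p/2}(μ_α^n;X)} ≤ K · ( ∫_{{-1,1}^n} ‖Σ_{i=1}^n δ_i ∂_i^α f‖_{L_p(μ_α^n;X)}^p dσ_n(δ) )^{1/p}. -/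
open Finset

noncomputable section

/-- The real sign of a Boolean coordinate: `true ↦ 1`, `false ↦ -1`. -/
def sgn (b : Bool) : ℝ := if b then 1 else -1

/-- Hamming distance on the discrete cube `{-1,1}^n ≃ Bool^n`. -/
def hamming {n : ℕ} (x y : Fin n → Bool) : ℕ :=
  (Finset.univ.filter fun i => x i ≠ y i).card

/-- Flip the `i`-th coordinate. -/
def flipc {ι : Type*} [DecidableEq ι] (x : ι → Bool) (i : ι) : ι → Bool :=
  Function.update x i (!(x i))

/-- Negate all coordinates (the antipodal map). -/
def negc {ι : Type*} (x : ι → Bool) : ι → Bool := fun i => !(x i)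

/-- `X` has Rademacher type `p` with constant `T`. -/
def RademacherType (X : Type*) [NormedAddCommGroup X] [NormedSpace ℝ X] (p T : ℝ) : Prop :=
  ∀ (m : ℕ) (v : Fin m → X),
    (2 ^ m : ℝ)⁻¹ * ∑ x : Fin m → Bool, ‖∑ i, sgn (x i) • v i‖ ^ p ≤
      T ^ p * ∑ i, ‖v i‖ ^ p

/-- `X` has cotype `q` with constant `Cq`. -/
def CotypeC (X : Type*) [NormedAddCommGroup X] [NormedSpace ℝ X] (q Cq : ℝ) : Prop :=
  ∀ (m : ℕ) (v : Fin m → X),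
    (∑ i, ‖v i‖ ^ q) / Cq ^ q ≤
      (2 ^ m : ℝ)⁻¹ * ∑ x : Fin m → Bool, ‖∑ i, sgn (x i) • v i‖ ^ q

open scoped Classical in
/-- The weak `ℓ_p` norm of a finite real vector. -/
def weakLp {ι : Type*} [Fintype ι] (p : ℝ) (w : ι → ℝ) : ℝ :=
  sSup {z | ∃ r : ℝ, 0 ≤ r ∧
    z = r * ((Finset.univ.filter fun i => r ≤ |w i|).card : ℝ) ^ (1 / p)}

/-- Metric stable type `p` with constant `S`. -/
def MetricStableType (M : Type*) [PseudoMetricSpace M] (p S : ℝ) : Prop :=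
  ∀ (n : ℕ) (f : (Fin n → Bool) → M),
    (2 ^ n : ℝ)⁻¹ * ∑ x : Fin n → Bool, dist (f x) (f (negc x)) ^ p ≤
      S ^ p * ((2 ^ n : ℝ)⁻¹ *
        ∑ x : Fin n → Bool, weakLp p (fun i => (1 / 2) * dist (f x) (f (flipc x i))) ^ p)

/-- The product biased measure weight of a point of the cube. -/
def biasedWeight {ι : Type*} [Fintype ι] (α : ι → ℝ) (x : ι → Bool) : ℝ :=
  ∏ i, if x i then α i else 1 - α i

/-- The biased discrete partial derivative `∂_i^α`. -/
def bder {ι : Type*} [DecidableEq ι] {X : Type*} [AddCommGroup X] [Module ℝ X]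
    (α : ℝ) (i : ι) (f : (ι → Bool) → X) (x : ι → Bool) : X :=
  f x - (α • f (Function.update x i true) + (1 - α) • f (Function.update x i false))

/-- The `L_p(μ; X)` norm with respect to the weight `μ` on the cube. -/
def lpNormW {ι : Type*} [Fintype ι] [DecidableEq ι] {X : Type*} [NormedAddCommGroup X]
    (μ : (ι → Bool) → ℝ) (p : ℝ) (g : (ι → Bool) → X) : ℝ :=
  (∑ x : ι → Bool, μ x * ‖g x‖ ^ p) ^ (1 / p)

/-- The Orlicz `L_p(log L)^{p/2}(μ; X)` norm with respect to the weight `μ` on the cube. -/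
def orliczNormW {ι : Type*} [Fintype ι] [DecidableEq ι] {X : Type*} [NormedAddCommGroup X]
    (μ : (ι → Bool) → ℝ) (p : ℝ) (g : (ι → Bool) → X) : ℝ :=
  sInf {γ : ℝ | 0 < γ ∧
    ∑ x : ι → Bool, (μ x * (‖g x‖ ^ p / γ ^ p)) *
      Real.log (Real.exp 1 + ‖g x‖ ^ p / γ ^ p) ^ (p / 2) ≤ 1}

/-- The one-dimensional transition kernel `p_t^α`. -/
def ptrans (t α : ℝ) : Bool → Bool → ℝ := fun a b =>
  match a, b with
  | true, true => 1 - (1 - Real.exp (-t)) * (1 - α)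
  | true, false => (1 - Real.exp (-t)) * (1 - α)
  | false, true => (1 - Real.exp (-t)) * α
  | false, false => 1 - (1 - Real.exp (-t)) * α

/-- The matrix `η_t^α(·,·;θ)`. -/
def eta (t α θ : ℝ) : Bool → Bool → ℝ := fun a b =>
  match a, b with
  | true, true => (Real.exp (-t) - θ) / ptrans t α true true
  | true, false => (-θ) / ptrans t α false true
  | false, true => (θ - Real.exp (-t)) / ptrans t α true false
  | false, false => θ / ptrans t α false false

/-- The product transition kernel `p_t^𝛂`. -/
def pprod {n : ℕ} (t : ℝ) (α : Fin n → ℝ) (x y : Fin n → Bool) : ℝ :=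
  ∏ i, ptrans t (α i) (x i) (y i)

/-- Glue coordinates on `σ` (given by `x`) with coordinates off `σ` (given by `w`). -/
def glue {n : ℕ} (σ : Finset (Fin n)) (x : {i // i ∈ σ} → Bool) (w : Fin n → Bool) :
    Fin n → Bool := fun j => if h : j ∈ σ then x ⟨j, h⟩ else w j

/-- The low-dimensional skeleton `𝒞_d^n` of the solid cube `[-1,1]^n`. -/
def cubeSkeleton (n d : ℕ) : Set (Fin n → ℝ) :=
  {x | (∀ i, |x i| ≤ 1) ∧ n - d ≤ {i | |x i| = 1}.ncard}

/-- The `ℓ_p^d` norm on `ℝ^d`. -/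
def lpnorm (p : ℝ) {d : ℕ} (v : Fin d → ℝ) : ℝ := (∑ k, |v k| ^ p) ^ (1 / p)

/-- The isoperimetric profile `x √(1 - log x)`. -/
def isoJ (x : ℝ) : ℝ := x * √(1 - Real.log x)

/-- One-sided discrete gradient length. -/
def mgrad {n : ℕ} (u : (Fin n → Bool) → ℝ) (x : Fin n → Bool) : ℝ :=
  √(∑ i, max 0 (u x - u (flipc x i)) ^ 2)

theorem isoJ_nonneg {x : ℝ} (hx : 0 ≤ x) : 0 ≤ isoJ x :=
  mul_nonneg hx (Real.sqrt_nonneg _)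

theorem isoJ_le_one {x : ℝ} (hx : 0 ≤ x) (hx1 : x ≤ 1) : isoJ x ≤ 1 := by
  rcases hx.eq_or_lt with rfl | hx
  · simp [isoJ]
  have h1 : 1 - Real.log x ≤ 1 / x := by
    have := Real.log_le_sub_one_of_pos (one_div_pos.2 hx)
    rw [one_div, Real.log_inv] at this
    rw [one_div]; linarith
  have h2 : √(1 - Real.log x) ≤ 1 / x := by
    apply Real.sqrt_le_iff.2 ⟨by positivity, h1.trans ?_⟩
    have : 1 ≤ 1 / x := by rw [le_div_iff₀ hx]; linarith
    nlinarith
  calc isoJ x ≤ x * (1 / x) := by unfold isoJ; gcongr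
    _ = 1 := by field_simp

theorem isoJ_two_point_of_le {β C : ℝ} (hβ : 0 < β) (hβ1 : β < 1) (hC : 2 / β ≤ C) {a b : ℝ}
    (hb : 0 ≤ b) (hba : b ≤ a) (ha : a ≤ 1) :
    isoJ (β * a + (1 - β) * b) ≤
      β * √(isoJ a ^ 2 + (C * (a - b)) ^ 2) + (1 - β) * isoJ b := by
  have hC2 : 2 ≤ C := by
    refine le_trans ?_ hC
    rw [le_div_iff₀ hβ]; linarith
  have hCβ : 2 ≤ C * β := by rwa [div_le_iff₀ hβ] at hC
  rcases (hb.trans hba).eq_or_lt with h0 | ha0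
  · have : b = 0 := le_antisymm (hba.trans h0.symm.le) hb
    subst this; subst h0; simp [isoJ]
  have hLa1 : 1 ≤ 1 - Real.log a := by linarith [Real.log_nonpos ha0.le ha]
  rcases hb.eq_or_lt with rfl | hb0
  · have hlog : Real.log (β * a) = Real.log β + Real.log a := Real.log_mul hβ.ne' ha0.ne'
    have hβl : - Real.log β ≤ 1 / β := by
      have := Real.log_le_sub_one_of_pos (one_div_pos.2 hβ)
      rw [one_div, Real.log_inv] at this
      rw [one_div]; linarith
    have hβC : 1 / β ≤ C ^ 2 := by
      rw [div_le_iff₀ hβ]; nlinarith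
    simp only [isoJ, mul_zero, add_zero, sub_zero, zero_mul]
    rw [mul_assoc]
    gcongr
    apply Real.le_sqrt_of_sq_le
    rw [mul_pow, mul_pow, mul_pow, Real.sq_sqrt, Real.sq_sqrt, hlog]
    · nlinarith [sq_nonneg a]
    · linarith
    · rw [hlog]; linarith [Real.log_nonpos hβ.le hβ1.le]
  set c := β * a + (1 - β) * b with hc
  clear_value c
  have p1 : 0 ≤ (1 - β) * b := mul_nonneg (by linarith) hb
  have p2 : 0 ≤ (1 - β) * (a - b) := mul_nonneg (by linarith) (by linarith)
  have p3 : 0 ≤ β * (a - b) := mul_nonneg hβ.le (by linarith)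
  have hcβ : β * a ≤ c := by linarith
  have hc0 : 0 < c := lt_of_lt_of_le (mul_pos hβ ha0) hcβ
  have hca : c ≤ a := by linarith
  have hbc : b ≤ c := by linarith
  have lca : Real.log c ≤ Real.log a := Real.log_le_log hc0 hca
  have lbc : Real.log b ≤ Real.log c := Real.log_le_log hb0 hbc
  set A := √(1 - Real.log a) with hA
  set B := √(1 - Real.log b) with hB
  set D := √(1 - Real.log c) with hD
  have A1 : 1 ≤ A := by rw [hA]; exact Real.one_le_sqrt.2 hLa1
  have AD : A ≤ D := Real.sqrt_le_sqrt (by linarith)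
  have DB : D ≤ B := Real.sqrt_le_sqrt (by linarith)
  have sA : A ^ 2 = 1 - Real.log a := Real.sq_sqrt (by linarith)
  have sB : B ^ 2 = 1 - Real.log b := Real.sq_sqrt (by linarith)
  have sD : D ^ 2 = 1 - Real.log c := Real.sq_sqrt (by linarith)
  have hBpos : 0 < B := by linarith
  have hApos : 0 < A := by linarith
  have hJc : isoJ c = c * D := rfl
  have hJb : isoJ b = b * B := rfl
  have hJa : isoJ a = a * A := rfl
  clear_value A B D
  have logdiv : ∀ {x y : ℝ}, 0 < x → 0 < y → Real.log x - Real.log y ≤ (x - y) / y := by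
    intro x y hx hy
    have := Real.log_le_sub_one_of_pos (div_pos hx hy)
    rw [Real.log_div hx.ne' hy.ne'] at this
    rwa [sub_div, div_self hy.ne']
  have e1 : D - A ≤ (a - c) / (c * (2 * A)) := by
    rw [le_div_iff₀ (by positivity)]
    have h := logdiv ha0 hc0
    rw [le_div_iff₀ hc0] at h
    have h' : (D - A) * (2 * A) ≤ Real.log a - Real.log c := by
      linarith [sq_nonneg (D - A), sub_sq D A]
    calc (D - A) * (c * (2 * A)) = (D - A) * (2 * A) * c := by ring
      _ ≤ (Real.log a - Real.log c) * c := by gcongr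
      _ ≤ _ := h
  have e2 : (c - b) / (c * (2 * B)) ≤ B - D := by
    rw [div_le_iff₀ (by positivity)]
    have h' : Real.log c - Real.log b ≤ (B - D) * (2 * B) := by
      linarith [sq_nonneg (B - D), sub_sq B D]
    have h2 := logdiv hb0 hc0
    rw [le_div_iff₀ hc0] at h2
    calc c - b ≤ (Real.log c - Real.log b) * c := by linarith
      _ ≤ (B - D) * (2 * B) * c := by gcongr
      _ = _ := by ring
  have e3 : B - A ≤ (a - b) / (b * (2 * A)) := by
    rw [le_div_iff₀ (by positivity)]
    have h := logdiv ha0 hb0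
    rw [le_div_iff₀ hb0] at h
    have h' : (B - A) * (2 * A) ≤ Real.log a - Real.log b := by
      linarith [sq_nonneg (B - A), sub_sq B A]
    calc (B - A) * (b * (2 * A)) = (B - A) * (2 * A) * b := by ring
      _ ≤ (Real.log a - Real.log b) * b := by gcongr
      _ ≤ _ := h
  have e4 : a / A - b / B ≤ 3 / 2 * (a - b) / A := by
    have : a / A - b / B = (a - b) / A + b * (B - A) / (A * B) := by
      field_simp; ring
    rw [this]
    have h : b * (B - A) / (A * B) ≤ 1 / 2 * (a - b) / A := by
      rw [div_le_div_iff₀ (by positivity) hApos]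
      rw [le_div_iff₀ (by positivity)] at e3
      have h5 : b * (B - A) ≤ 1 / 2 * (a - b) * B := by
        have q1 : 0 ≤ b * (B - A) := mul_nonneg hb (sub_nonneg.2 (AD.trans DB))
        have q2 : b * (B - A) * 1 ≤ b * (B - A) * A := mul_le_mul_of_nonneg_left A1 q1
        have q3 : (a - b) * 1 ≤ (a - b) * B :=
          mul_le_mul_of_nonneg_left (by linarith) (by linarith)
        linarith
      calc b * (B - A) * A ≤ 1 / 2 * (a - b) * B * A := by gcongr
        _ = _ := by ring
    calc _ ≤ (a - b) / A + 1 / 2 * (a - b) / A := by linarith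
      _ = _ := by ring
  have defect : isoJ c - β * isoJ a - (1 - β) * isoJ b ≤
      β * (3 / (4 * β) * (a - b) ^ 2 / (a * A)) := by
    have h1 : isoJ c - β * isoJ a - (1 - β) * isoJ b =
        β * a * (D - A) - (1 - β) * b * (B - D) := by
      rw [hJc, hJa, hJb]; linear_combination D * hc
    have h2 : β * a * (D - A) - (1 - β) * b * (B - D) ≤
        β * a * ((a - c) / (c * (2 * A))) - (1 - β) * b * ((c - b) / (c * (2 * B))) := by
      have := mul_le_mul_of_nonneg_left e1 (by positivity : 0 ≤ β * a)
      have := mul_le_mul_of_nonneg_left e2 (mul_nonneg (by linarith) hb : 0 ≤ (1 - β) * b)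
      linarith
    have h3 : β * a * ((a - c) / (c * (2 * A))) - (1 - β) * b * ((c - b) / (c * (2 * B))) =
        β * (1 - β) * (a - b) / (2 * c) * (a / A - b / B) := by
      have x1 : a - c = (1 - β) * (a - b) := by rw [hc]; ring
      have x2 : c - b = β * (a - b) := by rw [hc]; ring
      rw [x1, x2]; field_simp
    have h4 : β * (1 - β) * (a - b) / (2 * c) * (a / A - b / B) ≤
        β * (1 - β) * (a - b) / (2 * c) * (3 / 2 * (a - b) / A) := by
      apply mul_le_mul_of_nonneg_left e4
      apply div_nonneg _ (by positivity)
      exact mul_nonneg (mul_nonneg hβ.le (by linarith)) (by linarith)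
    have h5 : β * (1 - β) * (a - b) / (2 * c) * (3 / 2 * (a - b) / A) =
        β * (3 / 4 * (1 - β) * (a - b) ^ 2 / (c * A)) := by field_simp; ring
    rw [h1]
    refine h2.trans (h3.le.trans (h4.trans (h5.le.trans ?_)))
    apply mul_le_mul_of_nonneg_left _ hβ.le
    calc 3 / 4 * (1 - β) * (a - b) ^ 2 / (c * A) ≤ 3 / 4 * 1 * (a - b) ^ 2 / ((β * a) * A) := by
          gcongr; linarith
      _ = _ := by field_simp
  have hsq : 3 / (4 * β) * (a - b) ^ 2 / (a * A) ≤
      √(isoJ a ^ 2 + (C * (a - b)) ^ 2) - isoJ a := by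
    rw [le_sub_iff_add_le]
    apply Real.le_sqrt_of_sq_le
    rw [hJa]
    set J := a * A with hJ
    have hJpos : 0 < J := by positivity
    have hJab : a - b ≤ J := by
      have := mul_le_mul_of_nonneg_left A1 ha0.le
      linarith
    have hk : 3 / (4 * β) ≤ 3 * C / 8 := by
      rw [div_le_div_iff₀ (by positivity) (by norm_num)]; linarith
    have hk0 : 0 < 3 / (4 * β) := by positivity
    have hd0 : 0 ≤ a - b := by linarith
    generalize 3 / (4 * β) = k at *
    generalize a - b = d at *
    have h1 : (k * d ^ 2 / J) ^ 2 ≤ k ^ 2 * d ^ 2 := by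
      have : k * d ^ 2 / J ≤ k * d := by
        rw [div_le_iff₀ hJpos, sq, ← mul_assoc]; gcongr
      calc _ ≤ (k * d) ^ 2 := by gcongr
        _ = _ := by ring
    have h2 : k * d ^ 2 / J * J = k * d ^ 2 := by field_simp
    have h3 : k ^ 2 + 2 * k ≤ C ^ 2 := by
      have q1 : k ^ 2 ≤ (3 * C / 8) ^ 2 := by gcongr
      have q2 : 2 * C ≤ C ^ 2 := by rw [sq]; gcongr
      linarith [sq_nonneg C]
    linarith [mul_le_mul_of_nonneg_right h3 (sq_nonneg d)]
  have := mul_le_mul_of_nonneg_left hsq hβ.le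
  linarith

theorem isoJ_two_point {β C : ℝ} (hβ : 0 < β) (hβ1 : β < 1) (hC : 2 / β ≤ C)
    (hC' : 2 / (1 - β) ≤ C) {a b : ℝ} (ha0 : 0 ≤ a) (hb : 0 ≤ b) (ha : a ≤ 1) (hb1 : b ≤ 1) :
    isoJ (β * a + (1 - β) * b) ≤
      β * √(isoJ a ^ 2 + (C * max 0 (a - b)) ^ 2) +
        (1 - β) * √(isoJ b ^ 2 + (C * max 0 (b - a)) ^ 2) := by
  rcases le_total b a with h | h
  · have := isoJ_two_point_of_le hβ hβ1 hC hb h ha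
    rw [max_eq_right (by linarith : 0 ≤ a - b), max_eq_left (by linarith : b - a ≤ 0)]
    simpa [Real.sqrt_sq (isoJ_nonneg hb)] using this
  · have := isoJ_two_point_of_le (by linarith : 0 < 1 - β) (by linarith) hC' ha0 h hb1
    rw [max_eq_right (by linarith : 0 ≤ b - a), max_eq_left (by linarith : a - b ≤ 0)]
    have e : (1 - β) * b + (1 - (1 - β)) * a = β * a + (1 - β) * b := by ring
    rw [e] at this
    simp only [mul_zero, ne_eq, OfNat.ofNat_ne_zero, not_false_eq_true, zero_pow, add_zero,
      Real.sqrt_sq (isoJ_nonneg ha0)]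
    linarith

theorem sum_cube_succ {M : Type*} [AddCommMonoid M] {n : ℕ} (F : (Fin (n + 1) → Bool) → M) :
    ∑ x, F x = ∑ y : Fin n → Bool, F (Fin.cons true y) +
      ∑ y : Fin n → Bool, F (Fin.cons false y) := by
  rw [← (Fin.consEquiv (fun _ => Bool)).sum_comp, Fintype.sum_prod_type, Fintype.sum_bool]
  rfl

theorem flipc_cons_zero {n : ℕ} (b : Bool) (y : Fin n → Bool) :
    flipc (Fin.cons b y : Fin (n + 1) → Bool) 0 = Fin.cons (!b) y := by
  simp [flipc]

theorem flipc_cons_succ {n : ℕ} (b : Bool) (y : Fin n → Bool) (i : Fin n) :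
    flipc (Fin.cons b y : Fin (n + 1) → Bool) i.succ = Fin.cons b (flipc y i) := by
  simp [flipc, Fin.cons_update]

theorem biasedWeight_cons {n : ℕ} (α : ℝ) (b : Bool) (y : Fin n → Bool) :
    biasedWeight (fun _ : Fin (n + 1) => α) (Fin.cons b y) =
      (if b then α else 1 - α) * biasedWeight (fun _ : Fin n => α) y := by
  simp [biasedWeight, Fin.prod_univ_succ]

theorem biasedWeight_nonneg {n : ℕ} {α : ℝ} (h0 : 0 ≤ α) (h1 : α ≤ 1) (x : Fin n → Bool) :
    0 ≤ biasedWeight (fun _ : Fin n => α) x := by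
  apply Finset.prod_nonneg
  intro i _
  split_ifs <;> linarith

theorem sum_biasedWeight (n : ℕ) (α : ℝ) :
    ∑ x, biasedWeight (fun _ : Fin n => α) x = 1 := by
  induction n with
  | zero => simp [biasedWeight]
  | succ n ih =>
    rw [sum_cube_succ]
    simp only [biasedWeight_cons, ← Finset.mul_sum, ih]
    simp

theorem sqrt_sq_sum_le {ι : Type*} (s : Finset ι) (w A B : ι → ℝ) (hw : ∀ i, 0 ≤ w i) :
    √((∑ i ∈ s, w i * A i) ^ 2 + (∑ i ∈ s, w i * B i) ^ 2) ≤
      ∑ i ∈ s, w i * √(A i ^ 2 + B i ^ 2) := by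
  have h := norm_sum_le s (fun i => (w i : ℂ) * ((A i : ℂ) + B i * Complex.I))
  have e : ∑ i ∈ s, (w i : ℂ) * ((A i : ℂ) + B i * Complex.I) =
      ((∑ i ∈ s, w i * A i : ℝ) : ℂ) + ((∑ i ∈ s, w i * B i : ℝ) : ℂ) * Complex.I := by
    push_cast
    rw [Finset.sum_mul, ← Finset.sum_add_distrib]
    exact Finset.sum_congr rfl fun i _ => by ring
  rw [e, Complex.norm_add_mul_I] at h
  refine h.trans (le_of_eq (Finset.sum_congr rfl fun i _ => ?_))
  rw [norm_mul, Complex.norm_add_mul_I, Complex.norm_real, Real.norm_of_nonneg (hw i)]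

theorem mgrad_nonneg {n : ℕ} (u : (Fin n → Bool) → ℝ) (x : Fin n → Bool) : 0 ≤ mgrad u x :=
  Real.sqrt_nonneg _

theorem mgrad_cons_sq {n : ℕ} (u : (Fin (n + 1) → Bool) → ℝ) (b : Bool) (y : Fin n → Bool) :
    mgrad u (Fin.cons b y) ^ 2 = mgrad (fun y => u (Fin.cons b y)) y ^ 2 +
      max 0 (u (Fin.cons b y) - u (Fin.cons (!b) y)) ^ 2 := by
  unfold mgrad
  rw [Real.sq_sqrt (by positivity), Real.sq_sqrt (by positivity), Fin.sum_univ_succ, add_comm]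
  simp only [flipc_cons_zero, flipc_cons_succ]

/-- Bobkov-type inequality on the biased cube with the one-sided gradient. -/
theorem isoJ_sum_le {α C : ℝ} (hα : 0 < α) (hα1 : α < 1) (hC : 2 / α ≤ C)
    (hC' : 2 / (1 - α) ≤ C) (n : ℕ) (u : (Fin n → Bool) → ℝ) (hu0 : ∀ x, 0 ≤ u x)
    (hu1 : ∀ x, u x ≤ 1) :
    isoJ (∑ x, biasedWeight (fun _ : Fin n => α) x * u x) ≤
      ∑ x, biasedWeight (fun _ : Fin n => α) x * √(isoJ (u x) ^ 2 + (C * mgrad u x) ^ 2) := by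
  have hC0 : 0 ≤ C := le_trans (by positivity) hC
  induction n with
  | zero => simp [biasedWeight, mgrad, Real.sqrt_sq (isoJ_nonneg (hu0 _))]
  | succ n ih =>
    set W := fun y : Fin n → Bool => biasedWeight (fun _ : Fin n => α) y with hW
    have hWn : ∀ y, 0 ≤ W y := biasedWeight_nonneg hα.le hα1.le
    have hW1 : ∑ y, W y = 1 := sum_biasedWeight n α
    have bd : ∀ b, 0 ≤ ∑ y, W y * u (Fin.cons b y) ∧ ∑ y, W y * u (Fin.cons b y) ≤ 1 := by
      intro b
      refine ⟨Finset.sum_nonneg fun y _ => mul_nonneg (hWn y) (hu0 _), ?_⟩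
      rw [← hW1]
      exact Finset.sum_le_sum fun y _ => mul_le_of_le_one_right (hWn y) (hu1 _)
    have key : ∀ b, √(isoJ (∑ y, W y * u (Fin.cons b y)) ^ 2 +
          (C * max 0 (∑ y, W y * u (Fin.cons b y) - ∑ y, W y * u (Fin.cons (!b) y))) ^ 2) ≤
        ∑ y, W y * √(isoJ (u (Fin.cons b y)) ^ 2 + (C * mgrad u (Fin.cons b y)) ^ 2) := by
      intro b
      have h1 := ih (fun y => u (Fin.cons b y)) (fun _ => hu0 _) (fun _ => hu1 _)
      have h2 : C * max 0 (∑ y, W y * u (Fin.cons b y) - ∑ y, W y * u (Fin.cons (!b) y)) ≤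
          ∑ y, W y * (C * max 0 (u (Fin.cons b y) - u (Fin.cons (!b) y))) := by
        have : ∑ y, W y * (C * max 0 (u (Fin.cons b y) - u (Fin.cons (!b) y))) =
            C * ∑ y, W y * max 0 (u (Fin.cons b y) - u (Fin.cons (!b) y)) := by
          rw [Finset.mul_sum]; exact Finset.sum_congr rfl fun _ _ => by ring
        rw [this]
        apply mul_le_mul_of_nonneg_left _ hC0
        apply max_le
        · exact Finset.sum_nonneg fun y _ => mul_nonneg (hWn y) (le_max_left _ _)
        · rw [← Finset.sum_sub_distrib]
          refine Finset.sum_le_sum fun y _ => ?_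
          rw [← mul_sub]
          exact mul_le_mul_of_nonneg_left (le_max_right _ _) (hWn y)
      refine (Real.sqrt_le_sqrt (add_le_add (pow_le_pow_left₀ (isoJ_nonneg (bd b).1) h1 2)
        (pow_le_pow_left₀ (mul_nonneg hC0 (le_max_left _ _)) h2 2))).trans
        ((sqrt_sq_sum_le _ _ _ _ hWn).trans (le_of_eq (Finset.sum_congr rfl fun y _ => ?_)))
      rw [Real.sq_sqrt (by positivity), mul_pow C (mgrad u _), mgrad_cons_sq]
      congr 2
      ring
    rw [sum_cube_succ, sum_cube_succ]
    simp only [biasedWeight_cons, mul_assoc, ← Finset.mul_sum]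
    simp only [if_true, Bool.false_eq_true, if_false]
    have k1 := key true
    have k2 := key false
    simp only [Bool.not_true, Bool.not_false] at k1 k2
    refine (isoJ_two_point hα hα1 hC hC' (bd true).1 (bd false).1 (bd true).2 (bd false).2).trans ?_
    exact add_le_add (mul_le_mul_of_nonneg_left k1 hα.le)
      (mul_le_mul_of_nonneg_left k2 (by linarith))

/-- Lipschitz truncation at the dyadic levels `2 ^ k` and `2 ^ (k + 1)`. -/
def dyTrunc (k : ℕ) (t : ℝ) : ℝ := min (max (t / 2 ^ k - 1) 0) 1

theorem dyTrunc_nonneg (k : ℕ) (t : ℝ) : 0 ≤ dyTrunc k t :=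
  le_min (le_max_right _ _) zero_le_one

theorem dyTrunc_le_one (k : ℕ) (t : ℝ) : dyTrunc k t ≤ 1 := min_le_right _ _

theorem dyTrunc_eq_zero {k : ℕ} {t : ℝ} (h : t ≤ 2 ^ k) : dyTrunc k t = 0 := by
  have : t / 2 ^ k - 1 ≤ 0 := by
    rw [sub_nonpos, div_le_one (by positivity)]; exact h
  simp [dyTrunc, max_eq_right this]

theorem dyTrunc_eq_one {k : ℕ} {t : ℝ} (h : 2 ^ (k + 1) ≤ t) : dyTrunc k t = 1 := by
  have : 1 ≤ t / 2 ^ k - 1 := by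
    rw [le_sub_iff_add_le, le_div_iff₀ (by positivity)]
    rw [pow_succ] at h; linarith
  rw [dyTrunc, max_eq_left (by linarith), min_eq_right this]

theorem dyTrunc_sub_le (k : ℕ) (t s : ℝ) :
    dyTrunc k t - dyTrunc k s ≤ (2 ^ k)⁻¹ * max 0 (t - s) := by
  rcases le_total s t with h | h
  · rw [max_eq_right (by linarith)]
    have e : t / 2 ^ k - 1 = (s / 2 ^ k - 1) + (2 ^ k)⁻¹ * (t - s) := by
      field_simp; ring
    have h0 : 0 ≤ ((2 : ℝ) ^ k)⁻¹ * (t - s) := mul_nonneg (by positivity) (by linarith)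
    unfold dyTrunc
    rw [e]
    generalize ((2 : ℝ) ^ k)⁻¹ * (t - s) = d at *
    generalize s / 2 ^ k - 1 = r at *
    rcases max_cases (r + d) 0 with h1 | h1 <;> rcases max_cases r 0 with h2 | h2 <;>
      rcases min_cases (max (r + d) 0) 1 with h3 | h3 <;>
      rcases min_cases (max r 0) 1 with h4 | h4 <;> linarith
  · rw [max_eq_left (by linarith), mul_zero, sub_nonpos]
    unfold dyTrunc
    gcongr

theorem dyTrunc_sub_le_of_lt {k m : ℕ} {t s : ℝ} (hkm : k ≤ m) (hm : 2 ^ m ≤ t) :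
    dyTrunc k t - dyTrunc k s ≤ 2 * (2 ^ m)⁻¹ * max 0 (t - s) := by
  rcases Nat.lt_or_ge m (k + 2) with h | h
  · refine (dyTrunc_sub_le k t s).trans ?_
    apply mul_le_mul_of_nonneg_right _ (le_max_left _ _)
    rw [← div_eq_mul_inv, le_div_iff₀ (by positivity), inv_mul_le_iff₀ (by positivity)]
    have : (2 : ℝ) ^ m ≤ 2 ^ (k + 1) := pow_le_pow_right₀ (by norm_num) (by omega)
    rwa [pow_succ] at this
  · rcases le_total (2 ^ (k + 1)) s with hs | hs
    · rw [dyTrunc_eq_one hs]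
      have : 0 ≤ 2 * ((2 : ℝ) ^ m)⁻¹ * max 0 (t - s) := by positivity
      linarith [dyTrunc_le_one k t]
    · have h1 : (2 : ℝ) ^ (k + 1) * 2 ≤ 2 ^ m := by
        rw [← pow_succ]; exact pow_le_pow_right₀ (by norm_num) (by omega)
      have h2 : (2 : ℝ) ^ m / 2 ≤ max 0 (t - s) := le_trans (by linarith) (le_max_right _ _)
      have h3 : 2 * ((2 : ℝ) ^ m)⁻¹ * (2 ^ m / 2) ≤ 2 * (2 ^ m)⁻¹ * max 0 (t - s) := by gcongr
      have h4 : 2 * ((2 : ℝ) ^ m)⁻¹ * (2 ^ m / 2) = 1 := by field_simp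
      linarith [dyTrunc_le_one k t, dyTrunc_nonneg k s]

/-- The weights `2 ^ k √(k + 1)`. -/
def dyWeight (k : ℕ) : ℝ := 2 ^ k * √((k : ℝ) + 1)

theorem one_le_dyWeight (k : ℕ) : 1 ≤ dyWeight k := by
  have h1 : (1 : ℝ) ≤ 2 ^ k := one_le_pow₀ (by norm_num)
  have h2 : 1 ≤ √((k : ℝ) + 1) := Real.one_le_sqrt.2 (by simp)
  unfold dyWeight; nlinarith

theorem dyWeight_pos (k : ℕ) : 0 < dyWeight k := lt_of_lt_of_le one_pos (one_le_dyWeight k)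

theorem dyWeight_mul_pow_le {k m : ℕ} (h : k ≤ m) :
    dyWeight k * 2 ^ (m - k) ≤ dyWeight m := by
  unfold dyWeight
  have : (2 : ℝ) ^ m = 2 ^ k * 2 ^ (m - k) := by rw [← pow_add]; congr 1; omega
  rw [this]
  have : √((k : ℝ) + 1) ≤ √((m : ℝ) + 1) := Real.sqrt_le_sqrt (by gcongr)
  calc _ = 2 ^ k * 2 ^ (m - k) * √((k : ℝ) + 1) := by ring
    _ ≤ _ := by gcongr

theorem dyWeight_mono {k m : ℕ} (h : k ≤ m) : dyWeight k ≤ dyWeight m := by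
  refine le_trans ?_ (dyWeight_mul_pow_le h)
  exact le_mul_of_one_le_right (dyWeight_pos k).le (one_le_pow₀ (by norm_num))

theorem dyWeight_succ_le (k : ℕ) : dyWeight (k + 1) ≤ 4 * dyWeight k := by
  unfold dyWeight
  have : √(((k + 1 : ℕ) : ℝ) + 1) ≤ 2 * √((k : ℝ) + 1) := by
    apply Real.sqrt_le_iff.2 ⟨by positivity, ?_⟩
    rw [mul_pow, Real.sq_sqrt (by positivity)]
    push_cast; linarith [(Nat.cast_nonneg k : (0:ℝ) ≤ k)]
  rw [pow_succ]
  calc _ ≤ 2 ^ k * 2 * (2 * √((k : ℝ) + 1)) := by gcongr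
    _ = _ := by ring

theorem dyWeight_rpow_div (p : ℝ) (k : ℕ) :
    dyWeight k ^ p / √((k : ℝ) + 1) = 2 ^ k * dyWeight k ^ (p - 1) := by
  have h : dyWeight k ^ p = dyWeight k ^ (p - 1) * dyWeight k := by
    rw [← Real.rpow_add_one (dyWeight_pos k).ne']; congr 1; ring
  have h2 : 0 < √((k : ℝ) + 1) := by positivity
  rw [h, div_eq_iff h2.ne']
  conv_lhs => rw [dyWeight]
  rw [dyWeight]; ring

theorem sum_two_pow_le (m : ℕ) : ∑ k ∈ range (m + 1), (2 : ℝ) ^ k ≤ 2 * 2 ^ m := by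
  have h : ∑ k ∈ range (m + 1), (2 : ℝ) ^ k = 2 ^ (m + 1) - 1 := by
    have := geom_sum_eq (by norm_num : (2 : ℝ) ≠ 1) (m + 1)
    rw [this]; norm_num
  rw [h, pow_succ]; linarith

theorem dyWeight_rpow_le {p : ℝ} (hp : 1 ≤ p) {k m : ℕ} (h : k ≤ m) :
    dyWeight k ^ p ≤ 2 ^ k * ((2 ^ m)⁻¹ * dyWeight m ^ p) := by
  have h1 := dyWeight_mul_pow_le h
  have h2 : (dyWeight k * 2 ^ (m - k)) ^ p ≤ dyWeight m ^ p :=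
    Real.rpow_le_rpow (mul_nonneg (dyWeight_pos k).le (by positivity)) h1 (by linarith)
  rw [Real.mul_rpow (dyWeight_pos k).le (by positivity)] at h2
  have h3 : (2 : ℝ) ^ (m - k) ≤ ((2 : ℝ) ^ (m - k)) ^ p :=
    Real.self_le_rpow_of_one_le (one_le_pow₀ (by norm_num)) hp
  have h4 : (2 : ℝ) ^ m = 2 ^ k * 2 ^ (m - k) := by rw [← pow_add]; congr 1; omega
  have h5 : 0 < dyWeight k ^ p := Real.rpow_pos_of_pos (dyWeight_pos k) p
  have h6 : dyWeight k ^ p * 2 ^ (m - k) ≤ dyWeight m ^ p :=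
    (mul_le_mul_of_nonneg_left h3 h5.le).trans h2
  calc dyWeight k ^ p = 2 ^ k * ((2 ^ m)⁻¹ * (dyWeight k ^ p * 2 ^ (m - k))) := by
        rw [h4]; field_simp
    _ ≤ _ := by gcongr

theorem rpow_sub_one_mul_le {p η a b : ℝ} (hp : 1 ≤ p) (hη : 0 < η) (ha : 0 < a) (hb : 0 ≤ b) :
    a ^ (p - 1) * b ≤ η * a ^ p + η ^ (1 - p) * b ^ p := by
  have hap : 0 < a ^ p := Real.rpow_pos_of_pos ha p
  have hbp : 0 ≤ b ^ p := Real.rpow_nonneg hb p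
  have hηp : 0 < η ^ (1 - p) := Real.rpow_pos_of_pos hη _
  rcases le_total b (η * a) with h | h
  · calc a ^ (p - 1) * b ≤ a ^ (p - 1) * (η * a) := by gcongr
      _ = η * a ^ p := by
        rw [show p = (p - 1) + 1 by ring, Real.rpow_add_one ha.ne']; ring_nf
      _ ≤ _ := by linarith [mul_nonneg hηp.le hbp]
  · have hb0 : 0 < b := lt_of_lt_of_le (by positivity) h
    have hab : a ≤ b / η := by rw [le_div_iff₀ hη]; linarith
    calc a ^ (p - 1) * b ≤ (b / η) ^ (p - 1) * b := by
          gcongr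
      _ = η ^ (1 - p) * b ^ p := by
        rw [Real.div_rpow hb hη.le, show 1 - p = -(p - 1) by ring, Real.rpow_neg hη.le]
        rw [show b ^ p = b ^ (p - 1) * b by rw [← Real.rpow_add_one hb0.ne']; congr 1; ring]
        field_simp
      _ ≤ _ := by linarith [mul_nonneg hη.le hap.le]

/-- The dyadic level of a nonnegative real. -/
def dyLevel (t : ℝ) : ℕ := Nat.log 2 ⌊t⌋₊

theorem lt_two_pow_dyLevel (t : ℝ) : t < 2 ^ (dyLevel t + 1) := by
  have h := Nat.lt_pow_succ_log_self (by norm_num : 1 < 2) ⌊t⌋₊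
  have h2 := Nat.lt_floor_add_one t
  have h3 : ((⌊t⌋₊ : ℝ)) + 1 ≤ 2 ^ (dyLevel t + 1) := by
    exact_mod_cast h
  linarith

theorem two_pow_dyLevel_le {t : ℝ} (ht : 1 ≤ t) : 2 ^ dyLevel t ≤ t := by
  have h0 : ⌊t⌋₊ ≠ 0 := (Nat.floor_pos.2 ht).ne'
  have h := Nat.pow_log_le_self 2 h0
  have h2 := Nat.floor_le (by linarith : 0 ≤ t)
  have h3 : (2 : ℝ) ^ dyLevel t ≤ (⌊t⌋₊ : ℝ) := by exact_mod_cast h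
  linarith

theorem le_dyLevel {k : ℕ} {t : ℝ} (h : 2 ^ k < t) : k ≤ dyLevel t := by
  have := h.trans (lt_two_pow_dyLevel t)
  have := (pow_lt_pow_iff_right₀ (by norm_num : (1 : ℝ) < 2)).1 this
  omega

theorem rpow_mul_log_le {p t : ℝ} (hp : 1 ≤ p) (ht : 0 ≤ t) :
    t ^ p * Real.log (Real.exp 1 + t ^ p) ^ (p / 2) ≤
      (2 * √(3 * p)) ^ p * dyWeight (dyLevel t) ^ p := by
  set m := dyLevel t
  have h1 : t ≤ 2 * 2 ^ m := by
    have := lt_two_pow_dyLevel t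
    rw [pow_succ] at this; linarith
  have hy : 1 ≤ ((2 : ℝ) ^ (m + 1)) ^ p :=
    Real.one_le_rpow (one_le_pow₀ (by norm_num)) (by linarith)
  have htp : t ^ p ≤ ((2 : ℝ) ^ (m + 1)) ^ p :=
    Real.rpow_le_rpow ht (by rw [pow_succ]; linarith) (by linarith)
  have hlog : Real.log (Real.exp 1 + t ^ p) ≤ 3 * p * (m + 1) := by
    have he : 1 ≤ Real.exp 1 := Real.one_le_exp (by norm_num)
    calc Real.log (Real.exp 1 + t ^ p)
        ≤ Real.log (Real.exp 1 * (2 * ((2 : ℝ) ^ (m + 1)) ^ p)) := by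
          apply Real.log_le_log
          · have := Real.rpow_nonneg ht p
            positivity
          · nlinarith
      _ = 1 + (Real.log 2 + p * ((m + 1) * Real.log 2)) := by
          rw [Real.log_mul (by positivity) (by positivity), Real.log_exp,
            Real.log_mul (by norm_num) (by positivity), Real.log_rpow (by positivity),
            Real.log_pow]
          push_cast; ring
      _ ≤ 1 + (1 + p * ((m + 1) * 1)) := by
          have := Real.log_two_lt_d9
          gcongr <;> linarith
      _ ≤ _ := by
          have : 1 ≤ p * ((m : ℝ) + 1) := by nlinarith [(Nat.cast_nonneg m : (0:ℝ) ≤ m)]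
          linarith
  have hlog0 : 0 ≤ Real.log (Real.exp 1 + t ^ p) := by
    apply Real.log_nonneg
    linarith [Real.one_le_exp (by norm_num : (0:ℝ) ≤ 1), Real.rpow_nonneg ht p]
  have hs : (3 * p * ((m : ℝ) + 1)) ^ (p / 2) = (√(3 * p) * √((m : ℝ) + 1)) ^ p := by
    rw [← Real.sqrt_mul (by linarith), Real.sqrt_eq_rpow, ← Real.rpow_mul (by positivity)]
    congr 1; ring
  calc _ ≤ (2 * 2 ^ m) ^ p * (3 * p * ((m : ℝ) + 1)) ^ (p / 2) := by
        gcongr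
    _ = _ := by
        rw [hs, ← Real.mul_rpow (by positivity) (by positivity),
          ← Real.mul_rpow (by positivity) (dyWeight_pos _).le]
        congr 1
        unfold dyWeight; ring

theorem dyWeight_rpow_le_sum {p t : ℝ} (hp : 1 ≤ p) {K : ℕ} (hK : dyLevel t < K) :
    dyWeight (dyLevel t) ^ p ≤
      1 + (4 : ℝ) ^ p * ∑ k ∈ range K, dyWeight k ^ p * dyTrunc k t := by
  have hnn : ∀ k ∈ range K, 0 ≤ dyWeight k ^ p * dyTrunc k t := fun k _ =>
    mul_nonneg (Real.rpow_nonneg (dyWeight_pos k).le p) (dyTrunc_nonneg k t)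
  have hs := Finset.sum_nonneg hnn
  have h4 : (0 : ℝ) ≤ 4 ^ p := by positivity
  rcases Nat.eq_zero_or_pos (dyLevel t) with h | h
  · rw [h]
    have : dyWeight 0 = 1 := by simp [dyWeight]
    rw [this, Real.one_rpow]
    linarith [mul_nonneg h4 hs]
  · obtain ⟨j, hj⟩ : ∃ j, dyLevel t = j + 1 := ⟨dyLevel t - 1, by omega⟩
    have ht : 1 ≤ t := by
      by_contra hlt
      have : ⌊t⌋₊ = 0 := Nat.floor_eq_zero.2 (not_le.1 hlt)
      simp [dyLevel, this] at h
    have h1 := two_pow_dyLevel_le ht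
    rw [hj] at h1
    have h2 := Finset.single_le_sum hnn (Finset.mem_range.2 (by omega : j < K))
    rw [dyTrunc_eq_one h1, mul_one] at h2
    rw [hj]
    calc dyWeight (j + 1) ^ p ≤ (4 * dyWeight j) ^ p :=
          Real.rpow_le_rpow (dyWeight_pos _).le (dyWeight_succ_le j) (by linarith)
      _ = 4 ^ p * dyWeight j ^ p := Real.mul_rpow (by norm_num) (dyWeight_pos j).le
      _ ≤ _ := by linarith [mul_le_mul_of_nonneg_left h2 h4]

theorem mgrad_dyTrunc_le {n : ℕ} (g : (Fin n → Bool) → ℝ) (x : Fin n → Bool) (k : ℕ) :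
    mgrad (fun y => dyTrunc k (g y)) x ≤
      if k ≤ dyLevel (g x) then 2 * (2 ^ dyLevel (g x))⁻¹ * mgrad g x else 0 := by
  have hz : g x ≤ 2 ^ k → mgrad (fun y => dyTrunc k (g y)) x = 0 := by
    intro h
    have : ∀ i, max 0 (dyTrunc k (g x) - dyTrunc k (g (flipc x i))) = 0 := by
      intro i
      rw [dyTrunc_eq_zero h]
      exact max_eq_left (by linarith [dyTrunc_nonneg k (g (flipc x i))])
    simp [mgrad, this]
  rcases le_or_gt (g x) (2 ^ k) with h | h
  · rw [hz h]
    have := mgrad_nonneg g x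
    split_ifs <;> positivity
  · rw [if_pos (le_dyLevel h)]
    have h1 : (1 : ℝ) ≤ 2 ^ k := one_le_pow₀ (by norm_num)
    have hm := two_pow_dyLevel_le (h1.trans h.le)
    set c := 2 * ((2 : ℝ) ^ dyLevel (g x))⁻¹ with hc
    have hc0 : 0 ≤ c := by positivity
    unfold mgrad
    rw [← Real.sqrt_sq hc0, ← Real.sqrt_mul (sq_nonneg c), Finset.mul_sum]
    apply Real.sqrt_le_sqrt
    refine Finset.sum_le_sum fun i _ => ?_
    rw [← mul_pow]
    apply pow_le_pow_left₀ (le_max_left _ _)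
    exact max_le (mul_nonneg hc0 (le_max_left _ _)) (dyTrunc_sub_le_of_lt (le_dyLevel h) hm)

theorem sum_ite_le_eq {K m : ℕ} (hK : m < K) (F : ℕ → ℝ) :
    ∑ k ∈ range K, (if k ≤ m then F k else 0) = ∑ k ∈ range (m + 1), F k := by
  rw [← Finset.sum_filter]
  congr 1
  ext k; simp; omega

theorem sum_mgrad_dyTrunc_le {n : ℕ} {p : ℝ} (hp : 1 ≤ p) (g : (Fin n → Bool) → ℝ)
    (x : Fin n → Bool) {K : ℕ} (hK : dyLevel (g x) < K) :
    ∑ k ∈ range K, dyWeight k ^ p / √((k : ℝ) + 1) * mgrad (fun y => dyTrunc k (g y)) x ≤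
      4 * (dyWeight (dyLevel (g x)) ^ (p - 1) * mgrad g x) := by
  set m := dyLevel (g x)
  have hg := mgrad_nonneg g x
  have hw := Real.rpow_nonneg (dyWeight_pos m).le (p - 1)
  calc _ ≤ ∑ k ∈ range K, (if k ≤ m then
          2 ^ k * (2 * (2 ^ m)⁻¹ * (dyWeight m ^ (p - 1) * mgrad g x)) else 0) := by
        refine Finset.sum_le_sum fun k _ => ?_
        have h := mgrad_dyTrunc_le g x k
        rw [dyWeight_rpow_div]
        have h0 := Real.rpow_nonneg (dyWeight_pos k).le (p - 1)
        split_ifs at h ⊢ with hk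
        · have h3 := mgrad_nonneg (fun y => dyTrunc k (g y)) x
          have h2 : dyWeight k ^ (p - 1) ≤ dyWeight m ^ (p - 1) :=
            Real.rpow_le_rpow (dyWeight_pos k).le (dyWeight_mono hk) (by linarith)
          calc _ ≤ 2 ^ k * dyWeight m ^ (p - 1) * (2 * (2 ^ m)⁻¹ * mgrad g x) := by gcongr
            _ = _ := by ring
        · exact mul_nonpos_of_nonneg_of_nonpos (by positivity) h
    _ = (∑ k ∈ range (m + 1), (2 : ℝ) ^ k) *
          (2 * (2 ^ m)⁻¹ * (dyWeight m ^ (p - 1) * mgrad g x)) := by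
        rw [sum_ite_le_eq hK, Finset.sum_mul]
    _ ≤ (2 * 2 ^ m) * (2 * (2 ^ m)⁻¹ * (dyWeight m ^ (p - 1) * mgrad g x)) := by
        gcongr; exact sum_two_pow_le m
    _ = _ := by field_simp; ring

theorem sum_dyWeight_ite_le {p t : ℝ} (hp : 1 ≤ p) {K : ℕ} (hK : dyLevel t < K) (k₀ : ℕ) :
    ∑ k ∈ range K, dyWeight k ^ p / √((k : ℝ) + 1) * (if 2 ^ k < t then 1 else 0) ≤
      ∑ k ∈ range k₀, dyWeight k ^ p +
        2 / √((k₀ : ℝ) + 1) * dyWeight (dyLevel t) ^ p := by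
  set m := dyLevel t
  have hw : ∀ k, 0 ≤ dyWeight k ^ p := fun k => Real.rpow_nonneg (dyWeight_pos k).le p
  calc _ ≤ ∑ k ∈ range K, (if k ≤ m then
        ((if k < k₀ then dyWeight k ^ p else 0) +
          2 ^ k * ((2 ^ m)⁻¹ * dyWeight m ^ p) / √((k₀ : ℝ) + 1)) else 0) := by
        refine Finset.sum_le_sum fun k _ => ?_
        split_ifs with h1 h2 h3 h2 h3
        · have : 1 ≤ √((k : ℝ) + 1) := Real.one_le_sqrt.2 (by simp)
          rw [mul_one]
          have a1 : dyWeight k ^ p / √((k : ℝ) + 1) ≤ dyWeight k ^ p :=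
            div_le_self (hw k) this
          have a2 : 0 ≤ 2 ^ k * ((2 ^ m)⁻¹ * dyWeight m ^ p) / √((k₀ : ℝ) + 1) := by
            have := hw m; positivity
          linarith
        · rw [mul_one, zero_add]
          have a0 := dyWeight_rpow_le hp h2
          have a1 : √((k₀ : ℝ) + 1) ≤ √((k : ℝ) + 1) :=
            Real.sqrt_le_sqrt (by
              have : (k₀ : ℝ) ≤ k := by exact_mod_cast not_lt.1 h3
              linarith)
          have := hw k
          have := hw m
          gcongr
        · exact absurd (le_dyLevel h1) h2
        · have := hw m; have := hw k
          rw [mul_zero]; positivity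
        · have := hw m
          rw [mul_zero]; positivity
        · simp
    _ = ∑ k ∈ range (m + 1), (if k < k₀ then dyWeight k ^ p else 0) +
          (∑ k ∈ range (m + 1), (2 : ℝ) ^ k) * ((2 ^ m)⁻¹ * dyWeight m ^ p / √((k₀ : ℝ) + 1)) := by
        rw [sum_ite_le_eq hK, Finset.sum_add_distrib, Finset.sum_mul]
        congr 1
        exact Finset.sum_congr rfl fun k _ => by ring
    _ ≤ ∑ k ∈ range k₀, dyWeight k ^ p +
          (2 * 2 ^ m) * ((2 ^ m)⁻¹ * dyWeight m ^ p / √((k₀ : ℝ) + 1)) := by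
        apply add_le_add
        · rw [← Finset.sum_filter]
          apply Finset.sum_le_sum_of_subset_of_nonneg
          · intro k; simp
          · intro k _ _; exact hw k
        · have := hw m
          gcongr; exact sum_two_pow_le m
    _ = _ := by field_simp

/-- Isoperimetric bound for a dyadic truncation. -/
theorem sum_dyTrunc_le {α C : ℝ} (hα : 0 < α) (hα1 : α < 1) (hC : 2 / α ≤ C)
    (hC' : 2 / (1 - α) ≤ C) {n : ℕ} (g : (Fin n → Bool) → ℝ) (hg0 : ∀ x, 0 ≤ g x)
    (hg1 : ∑ x, biasedWeight (fun _ : Fin n => α) x * g x ≤ 1) (k : ℕ) :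
    √((k : ℝ) + 1) / 2 * ∑ x, biasedWeight (fun _ : Fin n => α) x * dyTrunc k (g x) ≤
      C * ∑ x, biasedWeight (fun _ : Fin n => α) x * mgrad (fun y => dyTrunc k (g y)) x +
      ∑ x, biasedWeight (fun _ : Fin n => α) x * (if 2 ^ k < g x then 1 else 0) := by
  set W := fun y : Fin n → Bool => biasedWeight (fun _ : Fin n => α) y with hW
  have hWn : ∀ y, 0 ≤ W y := biasedWeight_nonneg hα.le hα1.le
  have hC0 : 0 ≤ C := le_trans (by positivity) hC
  set e := ∑ x, W x * dyTrunc k (g x) with he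
  have he0 : 0 ≤ e := Finset.sum_nonneg fun x _ => mul_nonneg (hWn x) (dyTrunc_nonneg _ _)
  have hek : e ≤ (2 ^ k)⁻¹ := by
    calc e ≤ ∑ x, (2 ^ k)⁻¹ * (W x * g x) := by
          refine Finset.sum_le_sum fun x _ => ?_
          have : dyTrunc k (g x) ≤ (2 ^ k)⁻¹ * g x := by
            have h1 := dyTrunc_sub_le k (g x) 0
            rw [dyTrunc_eq_zero (by positivity : (0 : ℝ) ≤ 2 ^ k), sub_zero, sub_zero, max_eq_right (hg0 x)] at h1
            exact h1
          calc W x * dyTrunc k (g x) ≤ W x * ((2 ^ k)⁻¹ * g x) :=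
                mul_le_mul_of_nonneg_left this (hWn x)
            _ = _ := by ring
      _ = (2 ^ k)⁻¹ * ∑ x, W x * g x := by rw [Finset.mul_sum]
      _ ≤ (2 ^ k)⁻¹ * 1 := by gcongr
      _ = _ := mul_one _
  have hJ : √((k : ℝ) + 1) / 2 * e ≤ isoJ e := by
    rcases he0.eq_or_lt with h0 | h0
    · rw [← h0]; simp [isoJ]
    have hl : (k : ℝ) * Real.log 2 ≤ - Real.log e := by
      have := Real.log_le_log h0 hek
      rw [Real.log_inv, Real.log_pow] at this
      linarith
    have hlog2 := Real.log_two_gt_d9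
    have : √((k : ℝ) + 1) / 2 ≤ √(1 - Real.log e) := by
      apply Real.le_sqrt_of_sq_le
      rw [div_pow, Real.sq_sqrt (by positivity)]
      nlinarith [(Nat.cast_nonneg k : (0:ℝ) ≤ k)]
    rw [mul_comm]
    exact mul_le_mul_of_nonneg_left this he0
  refine hJ.trans ((isoJ_sum_le hα hα1 hC hC' n (fun x => dyTrunc k (g x))
    (fun _ => dyTrunc_nonneg _ _) (fun _ => dyTrunc_le_one _ _)).trans ?_)
  rw [Finset.mul_sum, ← Finset.sum_add_distrib]
  refine Finset.sum_le_sum fun x _ => ?_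
  have h1 : √(isoJ (dyTrunc k (g x)) ^ 2 + (C * mgrad (fun x => dyTrunc k (g x)) x) ^ 2) ≤
      C * mgrad (fun x => dyTrunc k (g x)) x + isoJ (dyTrunc k (g x)) := by
    have a1 := isoJ_nonneg (dyTrunc_nonneg k (g x))
    have a2 := mul_nonneg hC0 (mgrad_nonneg (fun x => dyTrunc k (g x)) x)
    apply Real.sqrt_le_iff.2 ⟨by linarith, ?_⟩
    nlinarith [mul_nonneg a1 a2]
  have h2 : isoJ (dyTrunc k (g x)) ≤ if 2 ^ k < g x then 1 else 0 := by
    split_ifs with h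
    · exact isoJ_le_one (dyTrunc_nonneg _ _) (dyTrunc_le_one _ _)
    · rw [dyTrunc_eq_zero (not_lt.1 h)]; simp [isoJ]
  calc _ ≤ W x * (C * mgrad (fun x => dyTrunc k (g x)) x + if 2 ^ k < g x then 1 else 0) :=
        mul_le_mul_of_nonneg_left (h1.trans (by linarith)) (hWn x)
    _ = _ := by ring

/-- Scalar Talagrand inequality in `L_p (log L)^{p/2}` for the one-sided gradient. -/
theorem exists_bound_sum_rpow_mul_log {α p : ℝ} (hα : 0 < α) (hα1 : α < 1) (hp : 1 ≤ p) :
    ∃ B : ℝ, 1 ≤ B ∧ ∀ (n : ℕ) (g : (Fin n → Bool) → ℝ), (∀ x, 0 ≤ g x) →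
      ∑ x, biasedWeight (fun _ : Fin n => α) x * g x ≤ 1 →
      ∑ x, biasedWeight (fun _ : Fin n => α) x * mgrad g x ^ p ≤ 1 →
      ∑ x, biasedWeight (fun _ : Fin n => α) x *
        (g x ^ p * Real.log (Real.exp 1 + g x ^ p) ^ (p / 2)) ≤ B := by
  obtain ⟨C, hC, hC'⟩ : ∃ C, 2 / α ≤ C ∧ 2 / (1 - α) ≤ C :=
    ⟨max _ _, le_max_left _ _, le_max_right _ _⟩
  have hC0 : 0 < C := lt_of_lt_of_le (by positivity) hC
  have h4p : (0 : ℝ) < 4 ^ p := by positivity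
  obtain ⟨k₀, hk₀⟩ : ∃ k₀ : ℕ, (16 * (4 : ℝ) ^ p) ^ 2 ≤ k₀ := exists_nat_ge _
  have hk₀' : 2 * 4 ^ p * (2 / √((k₀ : ℝ) + 1)) ≤ 1 / 4 := by
    have h : 16 * (4 : ℝ) ^ p ≤ √((k₀ : ℝ) + 1) := Real.le_sqrt_of_sq_le (by linarith)
    have h0 : 0 < √((k₀ : ℝ) + 1) := by positivity
    rw [← mul_div_assoc, div_le_iff₀ h0]; linarith
  set η := 1 / (32 * 4 ^ p * C) with hη
  have hη0 : 0 < η := by positivity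
  have hηC : 2 * 4 ^ p * (4 * C * η) ≤ 1 / 4 := by
    rw [hη]; apply le_of_eq; field_simp; norm_num
  set E := η ^ (1 - p) with hE
  have hE0 : 0 < E := Real.rpow_pos_of_pos hη0 _
  set T := ∑ k ∈ range k₀, dyWeight k ^ p with hT
  have hT0 : 0 ≤ T := Finset.sum_nonneg fun k _ => Real.rpow_nonneg (dyWeight_pos k).le p
  set B₀ := 2 * (1 + 2 * 4 ^ p * (4 * C * E + T)) with hB₀
  have hB₀0 : 0 ≤ B₀ := by positivity
  refine ⟨max 1 ((2 * √(3 * p)) ^ p * B₀), le_max_left _ _, fun n g hg0 hg1 hgp => ?_⟩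
  refine le_trans ?_ (le_max_right _ _)
  have hsum1 := sum_biasedWeight n α
  have hWn : ∀ y, 0 ≤ biasedWeight (fun _ : Fin n => α) y := biasedWeight_nonneg hα.le hα1.le
  have htr := sum_dyTrunc_le hα hα1 hC hC' g hg0 hg1
  generalize biasedWeight (fun _ : Fin n => α) = W at *
  set V := fun x => dyWeight (dyLevel (g x)) ^ p with hV
  set S := ∑ x, W x * V x with hS
  have hSB : S ≤ B₀ := by
    obtain ⟨K, hK⟩ : ∃ K, ∀ x, dyLevel (g x) < K := by
      refine ⟨∑ x, dyLevel (g x) + 1, fun x => ?_⟩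
      have := Finset.single_le_sum (f := fun x => dyLevel (g x)) (fun _ _ => Nat.zero_le _)
        (Finset.mem_univ x)
      exact Nat.lt_succ_of_le this
    have hw : ∀ k : ℕ, 0 ≤ dyWeight k ^ p / √((k : ℝ) + 1) := fun k =>
      div_nonneg (Real.rpow_nonneg (dyWeight_pos k).le p) (Real.sqrt_nonneg _)
    have s1 : S ≤ 1 + 4 ^ p * ∑ k ∈ range K, dyWeight k ^ p * ∑ x, W x * dyTrunc k (g x) := by
      calc S ≤ ∑ x, W x * (1 + (4 : ℝ) ^ p * ∑ k ∈ range K, dyWeight k ^ p * dyTrunc k (g x)) :=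
            Finset.sum_le_sum fun x _ =>
              mul_le_mul_of_nonneg_left (dyWeight_rpow_le_sum hp (hK x)) (hWn x)
        _ = _ := by
            simp only [mul_add, mul_one, Finset.sum_add_distrib, hsum1, Finset.mul_sum]
            rw [Finset.sum_comm]
            congr 1
            exact Finset.sum_congr rfl fun _ _ => Finset.sum_congr rfl fun _ _ => by ring
    have s2 : ∑ k ∈ range K, dyWeight k ^ p * ∑ x, W x * dyTrunc k (g x) ≤
        2 * ∑ k ∈ range K, dyWeight k ^ p / √((k : ℝ) + 1) *
          (C * ∑ x, W x * mgrad (fun y => dyTrunc k (g y)) x +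
            ∑ x, W x * (if 2 ^ k < g x then 1 else 0)) := by
      rw [Finset.mul_sum]
      refine Finset.sum_le_sum fun k _ => ?_
      have h := mul_le_mul_of_nonneg_left (htr k) (hw k)
      have h0 : 0 < √((k : ℝ) + 1) := by positivity
      have e : dyWeight k ^ p * ∑ x, W x * dyTrunc k (g x) =
          2 * (dyWeight k ^ p / √((k : ℝ) + 1) *
            (√((k : ℝ) + 1) / 2 * ∑ x, W x * dyTrunc k (g x))) := by
        field_simp
      rw [e]
      linarith
    have s3 : ∑ k ∈ range K, dyWeight k ^ p / √((k : ℝ) + 1) *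
          (C * ∑ x, W x * mgrad (fun y => dyTrunc k (g y)) x +
            ∑ x, W x * (if 2 ^ k < g x then 1 else 0)) =
        ∑ x, W x * (C * (∑ k ∈ range K, dyWeight k ^ p / √((k : ℝ) + 1) *
            mgrad (fun y => dyTrunc k (g y)) x) +
          ∑ k ∈ range K, dyWeight k ^ p / √((k : ℝ) + 1) * (if 2 ^ k < g x then 1 else 0)) := by
      simp only [Finset.mul_sum, ← Finset.sum_add_distrib]
      rw [Finset.sum_comm]
      exact Finset.sum_congr rfl fun _ _ => Finset.sum_congr rfl fun _ _ => by ring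
    have s4 : ∑ x, W x * (C * (∑ k ∈ range K, dyWeight k ^ p / √((k : ℝ) + 1) *
            mgrad (fun y => dyTrunc k (g y)) x) +
          ∑ k ∈ range K, dyWeight k ^ p / √((k : ℝ) + 1) * (if 2 ^ k < g x then 1 else 0)) ≤
        ∑ x, W x * (C * (4 * (η * V x + E * mgrad g x ^ p)) +
          (T + 2 / √((k₀ : ℝ) + 1) * V x)) := by
      refine Finset.sum_le_sum fun x _ => mul_le_mul_of_nonneg_left ?_ (hWn x)
      have h1 := sum_mgrad_dyTrunc_le hp g x (hK x)
      have h2 := rpow_sub_one_mul_le hp hη0 (dyWeight_pos (dyLevel (g x))) (mgrad_nonneg g x)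
      have h3 := sum_dyWeight_ite_le (t := g x) hp (hK x) k₀
      exact add_le_add (mul_le_mul_of_nonneg_left (h1.trans (by linarith)) hC0.le) h3
    have s5 : ∑ x, W x * (C * (4 * (η * V x + E * mgrad g x ^ p)) +
          (T + 2 / √((k₀ : ℝ) + 1) * V x)) =
        4 * C * η * S + 4 * C * E * ∑ x, W x * mgrad g x ^ p + T +
          2 / √((k₀ : ℝ) + 1) * S := by
      have : ∀ x, W x * (C * (4 * (η * V x + E * mgrad g x ^ p)) +
          (T + 2 / √((k₀ : ℝ) + 1) * V x)) = 4 * C * η * (W x * V x) +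
          4 * C * E * (W x * mgrad g x ^ p) + T * W x + 2 / √((k₀ : ℝ) + 1) * (W x * V x) :=
        fun x => by ring
      simp only [this, Finset.sum_add_distrib, ← Finset.mul_sum, hsum1, mul_one, hS]
    have hS0 : 0 ≤ S := Finset.sum_nonneg fun x _ =>
      mul_nonneg (hWn x) (Real.rpow_nonneg (dyWeight_pos _).le p)
    have s6 : 4 * C * E * ∑ x, W x * mgrad g x ^ p ≤ 4 * C * E * 1 := by gcongr
    have s7 : S ≤ 1 + 4 ^ p * (2 * (4 * C * η * S + 4 * C * E * 1 + T +
        2 / √((k₀ : ℝ) + 1) * S)) := by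
      refine s1.trans ?_
      gcongr
      refine s2.trans ?_
      rw [s3]
      linarith
    have s8 := mul_le_mul_of_nonneg_right hηC hS0
    have s9 := mul_le_mul_of_nonneg_right hk₀' hS0
    rw [hB₀]
    linarith
  calc _ ≤ ∑ x, W x * ((2 * √(3 * p)) ^ p * V x) := Finset.sum_le_sum fun x _ =>
        mul_le_mul_of_nonneg_left (rpow_mul_log_le hp (hg0 x)) (hWn x)
    _ = (2 * √(3 * p)) ^ p * S := by
        rw [hS, Finset.mul_sum]; exact Finset.sum_congr rfl fun _ _ => by ring
    _ ≤ _ := by gcongr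

theorem sum_rademacher_sq {n : ℕ} (a : Fin n → ℝ) :
    ∑ δ : Fin n → Bool, (∑ i, sgn (δ i) * a i) ^ 2 = 2 ^ n * ∑ i, a i ^ 2 := by
  induction n with
  | zero => simp
  | succ n ih =>
    rw [sum_cube_succ, ← Finset.sum_add_distrib]
    simp only [Fin.sum_univ_succ, Fin.cons_zero, Fin.cons_succ]
    have h : ∀ δ : Fin n → Bool, (sgn true * a 0 + ∑ i, sgn (δ i) * a i.succ) ^ 2 +
        (sgn false * a 0 + ∑ i, sgn (δ i) * a i.succ) ^ 2 =
        2 * a 0 ^ 2 + 2 * (∑ i, sgn (δ i) * a i.succ) ^ 2 := fun δ => by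
      simp [sgn]; ring
    simp only [h, Finset.sum_add_distrib, ← Finset.mul_sum, ih]
    simp; ring

theorem sum_rademacher_pow_four_le {n : ℕ} (a : Fin n → ℝ) :
    ∑ δ : Fin n → Bool, (∑ i, sgn (δ i) * a i) ^ 4 ≤ 2 ^ n * (3 * (∑ i, a i ^ 2) ^ 2) := by
  induction n with
  | zero => simp
  | succ n ih =>
    rw [sum_cube_succ, ← Finset.sum_add_distrib]
    simp only [Fin.sum_univ_succ, Fin.cons_zero, Fin.cons_succ]
    have h : ∀ δ : Fin n → Bool, (sgn true * a 0 + ∑ i, sgn (δ i) * a i.succ) ^ 4 +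
        (sgn false * a 0 + ∑ i, sgn (δ i) * a i.succ) ^ 4 =
        2 * a 0 ^ 4 + 12 * a 0 ^ 2 * (∑ i, sgn (δ i) * a i.succ) ^ 2 +
          2 * (∑ i, sgn (δ i) * a i.succ) ^ 4 := fun δ => by
      simp [sgn]; ring
    simp only [h, Finset.sum_add_distrib, ← Finset.mul_sum, sum_rademacher_sq]
    have := ih fun i => a i.succ
    simp only [Finset.sum_const, Finset.card_univ, Fintype.card_fun, Fintype.card_bool,
      Fintype.card_fin, nsmul_eq_mul, Nat.cast_pow, Nat.cast_ofNat, pow_succ (2 : ℝ) n]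
    have h2 : (0 : ℝ) ≤ 2 ^ n * a 0 ^ 4 := by positivity
    generalize ∑ δ : Fin n → Bool, (∑ i, sgn (δ i) * a i.succ) ^ 4 = F at *
    linarith

/-- The Khintchine inequality in `L_1`. -/
theorem sqrt_sum_sq_le_rademacher {n : ℕ} (a : Fin n → ℝ) :
    √(∑ i, a i ^ 2) ≤ 3 * ((2 ^ n : ℝ)⁻¹ * ∑ δ : Fin n → Bool, |∑ i, sgn (δ i) * a i|) := by
  set σ := √(∑ i, a i ^ 2) with hσ
  have hσ2 : σ ^ 2 = ∑ i, a i ^ 2 := Real.sq_sqrt (Finset.sum_nonneg fun i _ => sq_nonneg _)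
  have hσ0 : 0 ≤ σ := Real.sqrt_nonneg _
  clear_value σ
  rcases hσ0.eq_or_lt with h0 | h0
  · rw [← h0]; positivity
  have pt : ∀ s : ℝ, 3 * s ^ 2 / (4 * σ) - s ^ 4 / (16 * σ ^ 3) ≤ |s| := by
    intro s
    rw [← sq_abs s, show s ^ 4 = |s| ^ 4 by rw [← abs_pow, abs_of_nonneg (by positivity)]]
    generalize hr : |s| = r
    have hr0 : 0 ≤ r := hr ▸ abs_nonneg s
    have : 0 ≤ r * (r - 2 * σ) ^ 2 * (r + 4 * σ) / (16 * σ ^ 3) := by positivity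
    have e : r - (3 * r ^ 2 / (4 * σ) - r ^ 4 / (16 * σ ^ 3)) =
        r * (r - 2 * σ) ^ 2 * (r + 4 * σ) / (16 * σ ^ 3) := by
      field_simp; ring
    linarith
  have h1 : ∑ δ : Fin n → Bool, (3 * (∑ i, sgn (δ i) * a i) ^ 2 / (4 * σ) -
      (∑ i, sgn (δ i) * a i) ^ 4 / (16 * σ ^ 3)) ≤
      ∑ δ : Fin n → Bool, |∑ i, sgn (δ i) * a i| := Finset.sum_le_sum fun δ _ => pt _
  rw [Finset.sum_sub_distrib, ← Finset.sum_div, ← Finset.sum_div, ← Finset.mul_sum,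
    sum_rademacher_sq, ← hσ2] at h1
  have h4 := sum_rademacher_pow_four_le a
  rw [← hσ2] at h4
  have h5 : (∑ δ : Fin n → Bool, (∑ i, sgn (δ i) * a i) ^ 4) / (16 * σ ^ 3) ≤
      2 ^ n * (3 * (σ ^ 2) ^ 2) / (16 * σ ^ 3) := by gcongr
  have h6 : 3 * (2 ^ n * σ ^ 2) / (4 * σ) - 2 ^ n * (3 * (σ ^ 2) ^ 2) / (16 * σ ^ 3) =
      2 ^ n * (9 / 16 * σ) := by field_simp; ring
  have h7 : 9 / 16 * σ ≤ (2 ^ n : ℝ)⁻¹ * ∑ δ : Fin n → Bool, |∑ i, sgn (δ i) * a i| := by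
    rw [le_inv_mul_iff₀ (by positivity)]
    linarith
  linarith

section
variable {X : Type*} [NormedAddCommGroup X] [NormedSpace ℝ X]

/-- The Rademacher average of a finite sequence of vectors. -/
def radAvg {n : ℕ} (v : Fin n → X) : ℝ :=
  (2 ^ n : ℝ)⁻¹ * ∑ δ : Fin n → Bool, ‖∑ i, sgn (δ i) • v i‖

theorem radAvg_nonneg {n : ℕ} (v : Fin n → X) : 0 ≤ radAvg v := by
  unfold radAvg; positivity

theorem radAvg_smul {n : ℕ} (c : ℝ) (v : Fin n → X) :
    radAvg (fun i => c • v i) = |c| * radAvg v := by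
  unfold radAvg
  simp only [smul_comm _ c, ← Finset.smul_sum, norm_smul, Real.norm_eq_abs, ← Finset.mul_sum]
  ring

theorem radAvg_add_le {n : ℕ} (v w : Fin n → X) :
    radAvg (fun i => v i + w i) ≤ radAvg v + radAvg w := by
  unfold radAvg
  rw [← mul_add, ← Finset.sum_add_distrib]
  gcongr with δ
  simp only [smul_add, Finset.sum_add_distrib]
  exact norm_add_le _ _

theorem sum_sgn_smul_sgn {M : Type*} [AddCommMonoid M] {n : ℕ} (b : Fin n → Bool) (v : Fin n → X)
    (F : X → M) : ∑ δ : Fin n → Bool, F (∑ i, sgn (δ i) • sgn (b i) • v i) =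
      ∑ δ : Fin n → Bool, F (∑ i, sgn (δ i) • v i) := by
  have hinv : Function.Involutive (fun (δ : Fin n → Bool) i => (δ i == b i)) := by
    intro δ; funext i
    cases h1 : δ i <;> cases h2 : b i <;> simp [h1, h2]
  rw [← Equiv.sum_comp (hinv.toPerm _)]
  refine Finset.sum_congr rfl fun δ _ => congrArg F (Finset.sum_congr rfl fun i _ => ?_)
  rw [smul_smul, Function.Involutive.coe_toPerm]
  congr 1
  cases δ i <;> cases b i <;> simp [sgn]

theorem radAvg_sgn_smul {n : ℕ} (b : Fin n → Bool) (v : Fin n → X) :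
    radAvg (fun i => sgn (b i) • v i) = radAvg v := by
  unfold radAvg
  rw [sum_sgn_smul_sgn b v (fun z => ‖z‖)]

theorem mgrad_norm_le {n : ℕ} (f : (Fin n → Bool) → X) (x : Fin n → Bool) (c : Fin n → ℝ) {κ : ℝ}
    (w : Fin n → X) (hc : ∀ i, |c i| ≤ κ) (hκ : 0 ≤ κ)
    (hf : ∀ i, f (flipc x i) = f x - c i • w i) :
    mgrad (fun y => ‖f y‖) x ≤ 3 * κ * radAvg w := by
  obtain ⟨φ, hφ1, hφ⟩ := exists_dual_vector'' ℝ (f x)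
  have hle : ∀ z, φ z ≤ ‖z‖ := fun z =>
    (le_abs_self _).trans ((φ.le_opNorm z).trans (mul_le_of_le_one_left (norm_nonneg z) hφ1))
  have h1 : mgrad (fun y => ‖f y‖) x ≤ κ * √(∑ i, φ (w i) ^ 2) := by
    unfold mgrad
    rw [← Real.sqrt_sq hκ, ← Real.sqrt_mul (sq_nonneg κ), Finset.mul_sum]
    apply Real.sqrt_le_sqrt
    refine Finset.sum_le_sum fun i _ => ?_
    rw [← sq_abs (φ (w i)), ← mul_pow]
    apply pow_le_pow_left₀ (le_max_left _ _)
    apply max_le (by positivity)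
    have h2 := hle (f (flipc x i))
    have h3 : φ (f (flipc x i)) = ‖f x‖ - c i * φ (w i) := by
      rw [hf, map_sub, map_smul, hφ]; rfl
    have h4 : c i * φ (w i) ≤ κ * |φ (w i)| := by
      refine (le_abs_self _).trans ?_
      rw [abs_mul]
      exact mul_le_mul_of_nonneg_right (hc i) (abs_nonneg _)
    linarith
  have h2 := sqrt_sum_sq_le_rademacher (fun i => φ (w i))
  have h3 : (2 ^ n : ℝ)⁻¹ * ∑ δ : Fin n → Bool, |∑ i, sgn (δ i) * φ (w i)| ≤ radAvg w := by
    unfold radAvg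
    gcongr with δ
    have e : ∑ i, sgn (δ i) * φ (w i) = φ (∑ i, sgn (δ i) • w i) := by
      rw [map_sum]; exact Finset.sum_congr rfl fun i _ => by rw [map_smul]; rfl
    rw [e, ← Real.norm_eq_abs]
    exact (φ.le_opNorm _).trans (mul_le_of_le_one_left (norm_nonneg _) hφ1)
  calc _ ≤ κ * √(∑ i, φ (w i) ^ 2) := h1
    _ ≤ κ * (3 * radAvg w) := by gcongr; linarith
    _ = _ := by ring

theorem flipc_eq_sub_smul_bder {n : ℕ} {α : ℝ} (hα : 0 < α) (hα1 : α < 1)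
    (f : (Fin n → Bool) → X) (x : Fin n → Bool) (i : Fin n) :
    f (flipc x i) = f x - (if x i then (1 - α)⁻¹ else α⁻¹) • bder α i f x := by
  unfold bder flipc
  have hx : Function.update x i (x i) = x := Function.update_eq_self i x
  cases h : x i
  · rw [h] at hx
    simp only [hx, Bool.not_false, Bool.false_eq_true, if_false]
    have : f x - (α • f (Function.update x i true) + (1 - α) • f x) =
        α • (f x - f (Function.update x i true)) := by module
    rw [this, inv_smul_smul₀ hα.ne']; abel
  · rw [h] at hx
    simp only [hx, Bool.not_true, if_true]
    have : f x - (α • f x + (1 - α) • f (Function.update x i false)) =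
        (1 - α) • (f x - f (Function.update x i false)) := by module
    rw [this, inv_smul_smul₀ (by linarith)]; abel

theorem mgrad_norm_le_bder {n : ℕ} {α : ℝ} (hα : 0 < α) (hα1 : α < 1)
    (f : (Fin n → Bool) → X) (x : Fin n → Bool) :
    mgrad (fun y => ‖f y‖) x ≤
      3 * max (1 - α)⁻¹ α⁻¹ * radAvg (fun i => bder α i f x) := by
  have h1 : 0 < (1 - α)⁻¹ := inv_pos.2 (by linarith)
  have h2 : 0 < α⁻¹ := inv_pos.2 hα
  refine mgrad_norm_le f x _ _ (fun i => ?_) (h2.le.trans (le_max_right _ _))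
    (fun i => flipc_eq_sub_smul_bder hα hα1 f x i)
  split_ifs
  · rw [abs_of_pos h1]; exact le_max_left _ _
  · rw [abs_of_pos h2]; exact le_max_right _ _

theorem biasedWeight_half {n : ℕ} (x : Fin n → Bool) :
    biasedWeight (fun _ : Fin n => (1 / 2 : ℝ)) x = (2 ^ n : ℝ)⁻¹ := by
  have : ∀ i, (if x i then (1 / 2 : ℝ) else 1 - 1 / 2) = 2⁻¹ := by
    intro i; split_ifs <;> norm_num
  unfold biasedWeight
  rw [Finset.prod_congr rfl fun i _ => this i]
  simp

end

/-- The Kahane inequality. -/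
theorem exists_kahane {q : ℝ} (hq : 1 ≤ q) :
    ∃ K : ℝ, 0 < K ∧ ∀ (X : Type) [NormedAddCommGroup X] [NormedSpace ℝ X] (n : ℕ)
      (v : Fin n → X),
      (2 ^ n : ℝ)⁻¹ * ∑ δ : Fin n → Bool, ‖∑ i, sgn (δ i) • v i‖ ^ q ≤ K * radAvg v ^ q := by
  obtain ⟨B, hB1, hB⟩ := exists_bound_sum_rpow_mul_log (α := 1 / 2) (p := q) (by norm_num)
    (by norm_num) hq
  refine ⟨6 ^ q * B, by positivity, fun X _ _ n v => ?_⟩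
  rcases (radAvg_nonneg v).eq_or_lt with h0 | hR
  · have hz : ∀ δ : Fin n → Bool, ‖∑ i, sgn (δ i) • v i‖ = 0 := by
      have h1 : ∑ δ : Fin n → Bool, ‖∑ i, sgn (δ i) • v i‖ = 0 := by
        have h2 : (2 ^ n : ℝ)⁻¹ ≠ 0 := by positivity
        exact (mul_eq_zero.1 h0.symm).resolve_left h2
      exact fun δ => (Finset.sum_eq_zero_iff_of_nonneg fun _ _ => norm_nonneg _).1 h1 δ
        (Finset.mem_univ δ)
    simp only [hz, Real.zero_rpow (by linarith : q ≠ 0), ← h0]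
    simp
  · set R := radAvg v with hRdef
    set f : (Fin n → Bool) → X := fun x => (6 * R)⁻¹ • ∑ i, sgn (x i) • v i with hf
    have h6 : 0 < (6 * R)⁻¹ := by positivity
    have hnorm : ∀ x, ‖f x‖ = (6 * R)⁻¹ * ‖∑ i, sgn (x i) • v i‖ := fun x => by
      rw [hf, norm_smul, Real.norm_of_nonneg h6.le]
    have hflip : ∀ x i, f (flipc x i) = f x - (1 : ℝ) • ((2 * (6 * R)⁻¹) • sgn (x i) • v i) := by
      intro x i
      have : ∑ j, sgn (flipc x i j) • v j = ∑ j, sgn (x j) • v j - (2 * sgn (x i)) • v i := by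
        rw [eq_sub_iff_add_eq, ← Finset.add_sum_erase _ _ (Finset.mem_univ i),
          ← Finset.add_sum_erase univ (fun j => sgn (x j) • v j) (Finset.mem_univ i)]
        have e : ∑ j ∈ univ.erase i, sgn (flipc x i j) • v j =
            ∑ j ∈ univ.erase i, sgn (x j) • v j :=
          Finset.sum_congr rfl fun j hj => by
            rw [flipc, Function.update_of_ne (Finset.ne_of_mem_erase hj)]
        have e2 : sgn (flipc x i i) = - sgn (x i) := by
          rw [flipc, Function.update_self]
          cases x i <;> simp [sgn]
        rw [e, e2]
        module
      simp only [hf]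
      rw [this]
      module
    have hm : ∀ x, mgrad (fun y => ‖f y‖) x ≤ 1 := by
      intro x
      refine (mgrad_norm_le f x (fun _ => 1) (κ := 1) _ (by simp) zero_le_one (hflip x)).trans ?_
      rw [radAvg_smul, radAvg_sgn_smul, ← hRdef, abs_of_pos (by positivity)]
      apply le_of_eq; field_simp; norm_num
    have hb := hB n (fun x => ‖f x‖) (fun x => norm_nonneg _) (by
      simp only [biasedWeight_half, hnorm]
      have : ∑ x : Fin n → Bool, (2 ^ n : ℝ)⁻¹ * ((6 * R)⁻¹ * ‖∑ i, sgn (x i) • v i‖) =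
          (6 * R)⁻¹ * R := by
        rw [← Finset.mul_sum, ← Finset.mul_sum, mul_left_comm]
        rfl
      rw [this, inv_mul_le_iff₀ (by positivity)]; linarith) (by
      refine (Finset.sum_le_sum fun x _ => ?_).trans (sum_biasedWeight n (1 / 2)).le
      exact mul_le_of_le_one_right (biasedWeight_nonneg (by norm_num) (by norm_num) x)
        (Real.rpow_le_one (mgrad_nonneg _ _) (hm x) (by linarith)))
    simp only [biasedWeight_half, ← Finset.mul_sum] at hb
    have h1 : (2 ^ n : ℝ)⁻¹ * ∑ x, ‖f x‖ ^ q ≤ B := by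
      refine le_trans ?_ hb
      gcongr with x
      apply le_mul_of_one_le_right (by positivity)
      apply Real.one_le_rpow _ (by linarith)
      rw [Real.le_log_iff_exp_le (by positivity)]
      have : 0 ≤ ‖f x‖ ^ q := by positivity
      linarith
    have h2 : ∀ x, ‖∑ i, sgn (x i) • v i‖ ^ q = (6 * R) ^ q * ‖f x‖ ^ q := by
      intro x
      rw [← Real.mul_rpow (by positivity) (by positivity), hnorm]
      congr 1; field_simp
    calc _ = (6 * R) ^ q * ((2 ^ n : ℝ)⁻¹ * ∑ x, ‖f x‖ ^ q) := by
          simp only [h2, ← Finset.mul_sum]; ring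
      _ ≤ (6 * R) ^ q * B := by gcongr
      _ = _ := by rw [Real.mul_rpow (by norm_num) hR.le]; ring

/-- The product of the weights `w` along the coordinates of `x`. -/
def prodWeight {n : ℕ} {κ : Type*} (w : κ → ℝ) (x : Fin n → κ) : ℝ := ∏ i, w (x i)

theorem sum_prodWeight_comp {n : ℕ} {κ ι : Type*} [Fintype κ] [Fintype ι] [DecidableEq ι]
    (w : κ → ℝ) (w' : ι → ℝ) (φ : κ → ι)
    (hw : ∀ b, ∑ a with φ a = b, w a = w' b) (G : (Fin n → ι) → ℝ) :
    ∑ c : Fin n → κ, prodWeight w c * G (fun i => φ (c i)) =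
      ∑ r : Fin n → ι, prodWeight w' r * G r := by
  classical
  rw [← Finset.sum_fiberwise (s := univ) (g := fun (c : Fin n → κ) i => φ (c i))]
  refine Finset.sum_congr rfl fun r _ => ?_
  have h1 : ∀ c ∈ univ.filter (fun c : Fin n → κ => (fun i => φ (c i)) = r),
      prodWeight w c * G (fun i => φ (c i)) = prodWeight w c * G r := fun c hc => by
    rw [(Finset.mem_filter.1 hc).2]
  rw [Finset.sum_congr rfl h1, ← Finset.sum_mul]
  congr 1
  unfold prodWeight
  simp only [← hw]
  rw [Finset.prod_univ_sum]
  refine Finset.sum_congr ?_ fun _ _ => rfl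
  ext c
  simp [funext_iff]

section
variable {X : Type*} [NormedAddCommGroup X] [NormedSpace ℝ X]

theorem radAvg_elim_le {n N : ℕ} (c : Fin n → Option (Fin N)) (ε : Fin N → Bool) (v : Fin n → X) :
    radAvg (fun i => ((c i).elim 0 fun k => sgn (ε k)) • v i) ≤ radAvg v := by
  have e : (fun i => ((c i).elim 0 fun k => sgn (ε k)) • v i) = fun i =>
      (1 / 2 : ℝ) • (sgn ((c i).elim true ε) • v i) +
        (1 / 2 : ℝ) • (sgn ((c i).elim false ε) • v i) := by
    funext i
    cases c i
    · simp [sgn]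
    · simp only [Option.elim]; module
  rw [e]
  refine (radAvg_add_le _ _).trans ?_
  rw [radAvg_smul, radAvg_smul, radAvg_sgn_smul (fun i => (c i).elim true ε),
    radAvg_sgn_smul (fun i => (c i).elim false ε)]
  apply le_of_eq
  rw [abs_of_pos (by norm_num)]; ring

theorem rpow_radAvg_le {n : ℕ} {q : ℝ} (hq : 1 ≤ q) (v : Fin n → X) :
    radAvg v ^ q ≤ (2 ^ n : ℝ)⁻¹ * ∑ δ : Fin n → Bool, ‖∑ i, sgn (δ i) • v i‖ ^ q := by
  have := Real.rpow_arith_mean_le_arith_mean_rpow univ (fun _ : Fin n → Bool => (2 ^ n : ℝ)⁻¹)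
    (fun δ => ‖∑ i, sgn (δ i) • v i‖) (fun _ _ => by positivity) (by simp)
    (fun _ _ => norm_nonneg _) hq
  simp only [← Finset.mul_sum] at this
  exact this
end

theorem color_average_le {q Cq K : ℝ} (hq : 1 ≤ q) (hCq : 0 < Cq) (hK : 0 < K)
    {X : Type} [NormedAddCommGroup X] [NormedSpace ℝ X]
    (hX : CotypeC X q Cq)
    (hkah : ∀ (n : ℕ) (v : Fin n → X),
      (2 ^ n : ℝ)⁻¹ * ∑ δ : Fin n → Bool, ‖∑ i, sgn (δ i) • v i‖ ^ q ≤ K * radAvg v ^ q)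
    {n N : ℕ} (hN : 0 < N) (c : Fin n → Option (Fin N)) (v : Fin n → X) :
    (N : ℝ)⁻¹ * ∑ k, radAvg (fun i => if c i = some k then v i else 0) ≤
      (N : ℝ)⁻¹ ^ (1 / q) * (Cq * K ^ (1 / q)) * radAvg v := by
  have hN' : (0 : ℝ) < N := by exact_mod_cast hN
  set T : (Fin n → Bool) → Fin N → X := fun δ k =>
    ∑ i, sgn (δ i) • (if c i = some k then v i else 0) with hT
  have h1 : ∀ (δ : Fin n → Bool) (ε : Fin N → Bool), ∑ k, sgn (ε k) • T δ k =
      ∑ i, sgn (δ i) • ((c i).elim 0 fun k => sgn (ε k)) • v i := by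
    intro δ ε
    simp only [hT, Finset.smul_sum]
    rw [Finset.sum_comm]
    refine Finset.sum_congr rfl fun i _ => ?_
    rcases c i with _ | k
    · simp
    · rw [Finset.sum_eq_single k]
      · simp [smul_comm (sgn (ε k))]
      · intro b _ hb
        simp [hb.symm]
      · simp
  have h2 : ∑ k, (2 ^ n : ℝ)⁻¹ * ∑ δ, ‖T δ k‖ ^ q ≤ Cq ^ q * (K * radAvg v ^ q) := by
    have hCqq : 0 < Cq ^ q := by positivity
    calc ∑ k, (2 ^ n : ℝ)⁻¹ * ∑ δ, ‖T δ k‖ ^ q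
        = (2 ^ n : ℝ)⁻¹ * ∑ δ, ∑ k, ‖T δ k‖ ^ q := by
          rw [← Finset.mul_sum, Finset.sum_comm]
      _ ≤ (2 ^ n : ℝ)⁻¹ * ∑ δ, Cq ^ q *
            ((2 ^ N : ℝ)⁻¹ * ∑ ε : Fin N → Bool, ‖∑ k, sgn (ε k) • T δ k‖ ^ q) := by
          gcongr with δ
          have := hX N (T δ)
          rwa [div_le_iff₀' hCqq] at this
      _ = Cq ^ q * ((2 ^ N : ℝ)⁻¹ * ∑ ε : Fin N → Bool,
            (2 ^ n : ℝ)⁻¹ * ∑ δ, ‖∑ k, sgn (ε k) • T δ k‖ ^ q) := by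
          simp only [← Finset.mul_sum]
          rw [Finset.sum_comm]; ring
      _ ≤ Cq ^ q * ((2 ^ N : ℝ)⁻¹ * ∑ ε : Fin N → Bool, K * radAvg v ^ q) := by
          have h3 : ∀ ε : Fin N → Bool,
              (2 ^ n : ℝ)⁻¹ * ∑ δ, ‖∑ k, sgn (ε k) • T δ k‖ ^ q ≤ K * radAvg v ^ q := by
            intro ε
            simp only [h1]
            refine (hkah n _).trans ?_
            gcongr
            · exact radAvg_nonneg _
            · exact radAvg_elim_le c ε v
          have h4 := Finset.sum_le_sum fun ε (_ : ε ∈ (univ : Finset (Fin N → Bool))) => h3 ε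
          gcongr
      _ = _ := by simp
  have h3 : ((N : ℝ)⁻¹ * ∑ k, radAvg (fun i => if c i = some k then v i else 0)) ^ q ≤
      (N : ℝ)⁻¹ * (Cq ^ q * (K * radAvg v ^ q)) := by
    have := Real.rpow_arith_mean_le_arith_mean_rpow univ (fun _ : Fin N => (N : ℝ)⁻¹)
      (fun k => radAvg (fun i => if c i = some k then v i else 0))
      (fun _ _ => by positivity) (by simp [hN'.ne']) (fun _ _ => radAvg_nonneg _) hq
    simp only [← Finset.mul_sum] at this
    refine this.trans ?_
    gcongr
    refine le_trans (Finset.sum_le_sum fun k _ => ?_) h2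
    exact rpow_radAvg_le hq _
  have hq0 : 0 < q := by linarith
  have h0 : 0 ≤ (N : ℝ)⁻¹ * ∑ k, radAvg (fun i => if c i = some k then v i else 0) :=
    mul_nonneg (by positivity) (Finset.sum_nonneg fun _ _ => radAvg_nonneg _)
  have hv := radAvg_nonneg v
  have h4 := Real.rpow_le_rpow (by positivity) h3 (by positivity : 0 ≤ 1 / q)
  rw [← Real.rpow_mul h0, mul_one_div_cancel hq0.ne', Real.rpow_one] at h4
  refine h4.trans (le_of_eq ?_)
  rw [Real.mul_rpow (by positivity) (by positivity), Real.mul_rpow (by positivity) (by positivity),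
    Real.mul_rpow (by positivity) (by positivity), ← Real.rpow_mul hCq.le, ← Real.rpow_mul hv,
    mul_one_div_cancel hq0.ne', Real.rpow_one, Real.rpow_one]
  ring

/-- Random selectors in a space of nontrivial cotype. -/
theorem sum_biasedWeight_radAvg_select_le {q Cq K : ℝ} (hq : 1 ≤ q) (hCq : 0 < Cq) (hK : 0 < K)
    {X : Type} [NormedAddCommGroup X] [NormedSpace ℝ X]
    (hX : CotypeC X q Cq)
    (hkah : ∀ (n : ℕ) (v : Fin n → X),
      (2 ^ n : ℝ)⁻¹ * ∑ δ : Fin n → Bool, ‖∑ i, sgn (δ i) • v i‖ ^ q ≤ K * radAvg v ^ q)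
    {n : ℕ} {s : ℝ} (hs : 0 < s) (hs1 : s < 1) (v : Fin n → X) :
    ∑ r : Fin n → Bool, biasedWeight (fun _ => s) r *
        radAvg (fun i => if r i = true then v i else 0) ≤
      2 * (Cq * K ^ (1 / q)) * s ^ (1 / q) * radAvg v := by
  set N := ⌊s⁻¹⌋₊ with hNdef
  have hs' : 1 ≤ s⁻¹ := (one_le_inv₀ hs).2 hs1.le
  have hN : 0 < N := Nat.floor_pos.2 hs'
  have hN1 : (1 : ℝ) ≤ N := by exact_mod_cast hN
  have hNs : (N : ℝ) * s ≤ 1 := by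
    have := Nat.floor_le (inv_pos.2 hs).le
    calc (N : ℝ) * s ≤ s⁻¹ * s := by gcongr
      _ = 1 := inv_mul_cancel₀ hs.ne'
  have hNi : (N : ℝ)⁻¹ ≤ 2 * s := by
    have h1 := Nat.lt_floor_add_one s⁻¹
    rw [← hNdef] at h1
    rw [inv_le_comm₀ (by linarith) (by linarith), mul_inv]
    linarith
  set w : Option (Fin N) → ℝ := fun o => o.elim (1 - N * s) fun _ => s with hw
  have hw0 : ∀ o, 0 ≤ w o := by
    rintro (_ | k)
    · simp only [hw, Option.elim]; linarith
    · exact hs.le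
  have hsumw : ∑ o, w o = 1 := by
    rw [Fintype.sum_option]; simp [hw]
  have hwt : ∀ c : Fin n → Option (Fin N), 0 ≤ prodWeight w c :=
    fun c => Finset.prod_nonneg fun i _ => hw0 _
  have hpush : ∀ k : Fin N, ∑ c : Fin n → Option (Fin N), prodWeight w c *
      radAvg (fun i => if c i = some k then v i else 0) =
      ∑ r : Fin n → Bool, biasedWeight (fun _ => s) r *
        radAvg (fun i => if r i = true then v i else 0) := by
    intro k
    have := sum_prodWeight_comp (n := n) w (fun b : Bool => if b then s else 1 - s)
      (fun o => decide (o = some k)) (by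
        have ht : ∑ a with decide (a = some k) = true, w a = s := by
          simp only [decide_eq_true_eq, Finset.filter_eq']
          simp [hw]
        intro b
        cases b
        · have := Finset.sum_filter_add_sum_filter_not univ
            (fun a : Option (Fin N) => decide (a = some k) = true) w
          rw [ht, hsumw] at this
          simp only [Bool.not_eq_true] at this
          simp only [Bool.false_eq_true, if_false]
          linarith
        · simpa using ht)
      (fun r => radAvg (fun i => if r i = true then v i else 0))
    simp only [decide_eq_true_eq] at this
    exact this
  have htot : ∑ c : Fin n → Option (Fin N), prodWeight w c = 1 := by
    unfold prodWeight
    rw [← Fintype.piFinset_univ, ← Finset.prod_univ_sum, hsumw]; simp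
  have hv := radAvg_nonneg v
  have hconst : 0 ≤ Cq * K ^ (1 / q) := by positivity
  calc _ = (N : ℝ)⁻¹ * ∑ k : Fin N, ∑ c : Fin n → Option (Fin N), prodWeight w c *
        radAvg (fun i => if c i = some k then v i else 0) := by
        rw [Finset.sum_congr rfl fun k _ => hpush k]
        simp only [Finset.sum_const, Finset.card_univ, Fintype.card_fin, nsmul_eq_mul]
        rw [inv_mul_cancel_left₀ (by positivity)]
    _ = ∑ c : Fin n → Option (Fin N), prodWeight w c * ((N : ℝ)⁻¹ * ∑ k : Fin N,
        radAvg (fun i => if c i = some k then v i else 0)) := by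
        rw [Finset.sum_comm, Finset.mul_sum]
        refine Finset.sum_congr rfl fun c _ => ?_
        rw [← Finset.mul_sum]; ring
    _ ≤ ∑ c : Fin n → Option (Fin N), prodWeight w c *
        ((N : ℝ)⁻¹ ^ (1 / q) * (Cq * K ^ (1 / q)) * radAvg v) :=
        Finset.sum_le_sum fun c _ =>
          mul_le_mul_of_nonneg_left (color_average_le hq hCq hK hX hkah hN c v) (hwt c)
    _ = (N : ℝ)⁻¹ ^ (1 / q) * (Cq * K ^ (1 / q)) * radAvg v := by
        rw [← Finset.sum_mul, htot, one_mul]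
    _ ≤ (2 * s ^ (1 / q)) * (Cq * K ^ (1 / q)) * radAvg v := by
        gcongr
        calc (N : ℝ)⁻¹ ^ (1 / q) ≤ (2 * s) ^ (1 / q) := by gcongr
          _ = 2 ^ (1 / q) * s ^ (1 / q) := Real.mul_rpow (by norm_num) hs.le
          _ ≤ 2 * s ^ (1 / q) := by
            gcongr
            refine (Real.rpow_le_rpow_of_exponent_le (by norm_num)
              ((div_le_one (by linarith)).2 hq)).trans (Real.rpow_one 2).le
    _ = _ := by ring

/-- Take the coordinates selected by `r` from `z` and the others from `x`. -/
def mixc {n : ℕ} (r x z : Fin n → Bool) : Fin n → Bool := fun i => if r i then z i else x i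

theorem mixc_mixc {n : ℕ} (r x z : Fin n → Bool) : mixc r (mixc r x z) (mixc r z x) = x := by
  funext i; unfold mixc; cases r i <;> simp

theorem sum_mixc {n : ℕ} (a : Fin n → ℝ) (r : Fin n → Bool)
    (Ψ : (Fin n → Bool) → (Fin n → Bool) → ℝ) :
    ∑ x, ∑ z, biasedWeight a x * biasedWeight a z * Ψ (mixc r x z) (mixc r z x) =
      ∑ x, ∑ z, biasedWeight a x * biasedWeight a z * Ψ x z := by
  have hinv : Function.Involutive (fun w : (Fin n → Bool) × (Fin n → Bool) =>
      (mixc r w.1 w.2, mixc r w.2 w.1)) := fun w => by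
    simp only [mixc_mixc]
  simp only [← Fintype.sum_prod_type']
  rw [← Equiv.sum_comp (hinv.toPerm _)]
  refine Finset.sum_congr rfl fun w _ => ?_
  simp only [Function.Involutive.coe_toPerm, mixc_mixc]
  congr 1
  unfold biasedWeight
  rw [← Finset.prod_mul_distrib, ← Finset.prod_mul_distrib]
  refine Finset.prod_congr rfl fun i _ => ?_
  unfold mixc
  cases r i
  · simp
  · simp only [if_true]; ring

theorem sum_mixc_fst {n : ℕ} (α : ℝ) (r : Fin n → Bool) (Ψ : (Fin n → Bool) → ℝ) :
    ∑ x, ∑ z, biasedWeight (fun _ : Fin n => α) x * biasedWeight (fun _ : Fin n => α) z *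
        Ψ (mixc r x z) = ∑ y, biasedWeight (fun _ : Fin n => α) y * Ψ y := by
  rw [sum_mixc _ r (fun x _ => Ψ x)]
  refine Finset.sum_congr rfl fun x _ => ?_
  rw [← Finset.sum_mul, ← Finset.mul_sum, sum_biasedWeight, mul_one]

/-- The derivative of the biased weight of `r` with respect to the bias of the coordinate `i`. -/
def biasedWeightDeriv {n : ℕ} (s : ℝ) (r : Fin n → Bool) (i : Fin n) : ℝ :=
  (∏ j ∈ univ.erase i, if r j then s else 1 - s) * sgn (r i)

theorem hasDerivAt_biasedWeight {n : ℕ} (r : Fin n → Bool) (s : ℝ) :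
    HasDerivAt (fun s => biasedWeight (fun _ : Fin n => s) r)
      (∑ i, biasedWeightDeriv s r i) s := by
  unfold biasedWeight biasedWeightDeriv
  have h : ∀ i ∈ (univ : Finset (Fin n)),
      HasDerivAt (fun s : ℝ => if r i then s else 1 - s) (sgn (r i)) s := by
    intro i _
    cases r i
    · simpa [sgn] using (hasDerivAt_id s).const_sub 1
    · simpa [sgn] using hasDerivAt_id' s
  simpa [smul_eq_mul] using HasDerivAt.fun_finsetProd h

theorem sum_biasedWeightDeriv_smul {n : ℕ} {X : Type*} [AddCommGroup X] [Module ℝ X]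
    (s : ℝ) (i : Fin n) (G : (Fin n → Bool) → X) (hG : ∀ r, G (flipc r i) = G r) :
    ∑ r, biasedWeightDeriv s r i • G r = 0 := by
  refine Finset.sum_involution (fun r _ => flipc r i) (fun r _ => ?_) (fun r _ _ h => ?_)
    (fun r _ => Finset.mem_univ _) (fun r _ => ?_)
  · rw [hG, ← add_smul]
    have : biasedWeightDeriv s r i + biasedWeightDeriv s (flipc r i) i = 0 := by
      unfold biasedWeightDeriv
      have e : ∏ j ∈ univ.erase i, (if flipc r i j then s else 1 - s) =
          ∏ j ∈ univ.erase i, if r j then s else 1 - s :=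
        Finset.prod_congr rfl fun j hj => by
          rw [flipc, Function.update_of_ne (Finset.ne_of_mem_erase hj)]
      have e2 : sgn (flipc r i i) = - sgn (r i) := by
        rw [flipc, Function.update_self]
        cases r i <;> simp [sgn]
      rw [e, e2]; ring
    rw [this, zero_smul]
  · have := congrFun h i
    rw [flipc, Function.update_self] at this
    cases hr : r i <;> simp [hr] at this
  · unfold flipc
    simp

/-- The logarithmic derivative of the Bernoulli weight. -/
def scoreB (s : ℝ) (b : Bool) : ℝ := if b then s⁻¹ else -(1 - s)⁻¹

theorem biasedWeightDeriv_eq {n : ℕ} {s : ℝ} (hs : 0 < s) (hs1 : s < 1) (r : Fin n → Bool)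
    (i : Fin n) : biasedWeightDeriv s r i =
      biasedWeight (fun _ : Fin n => s) r * scoreB s (r i) := by
  have h1 : 1 - s ≠ 0 := by linarith
  unfold biasedWeightDeriv biasedWeight scoreB
  rw [← Finset.mul_prod_erase _ _ (Finset.mem_univ i)]
  cases r i
  · simp only [Bool.false_eq_true, if_false, sgn]; field_simp
  · simp only [if_true, sgn]; field_simp

theorem sum_biasedWeight_not {n : ℕ} (s : ℝ) (G : (Fin n → Bool) → ℝ) :
    ∑ r, biasedWeight (fun _ : Fin n => s) r * G (fun i => !(r i)) =
      ∑ r, biasedWeight (fun _ : Fin n => 1 - s) r * G r := by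
  have hinv : Function.Involutive (fun (r : Fin n → Bool) i => !(r i)) := fun r => by
    funext i; simp
  rw [← Equiv.sum_comp (hinv.toPerm _)]
  refine Finset.sum_congr rfl fun r _ => ?_
  simp only [Function.Involutive.coe_toPerm, Bool.not_not]
  congr 1
  unfold biasedWeight
  refine Finset.prod_congr rfl fun i _ => ?_
  cases h : r i <;> simp [h]

section
variable {X : Type*} [NormedAddCommGroup X] [NormedSpace ℝ X]

theorem sum_score_norm_le_radAvg {n : ℕ} {s : ℝ} (hs : 0 < s) (hs1 : s < 1) (v : Fin n → X) :
    ∑ r, biasedWeight (fun _ : Fin n => s) r * ‖∑ i, scoreB s (r i) • v i‖ ≤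
      2 * ∑ r, biasedWeight (fun _ : Fin n => s) r * radAvg (fun i => scoreB s (r i) • v i) := by
  have hB : ∀ r, 0 ≤ biasedWeight (fun _ : Fin n => s) r :=
    fun r => biasedWeight_nonneg hs.le hs1.le r
  have hB1 := sum_biasedWeight n s
  set B := biasedWeight (fun _ : Fin n => s) with hBdef
  set U : (Fin n → Bool) → X := fun r => ∑ i, scoreB s (r i) • v i with hU
  have hmean : ∑ r, B r • U r = 0 := by
    simp only [hU, Finset.smul_sum]
    rw [Finset.sum_comm]
    refine Finset.sum_eq_zero fun i _ => ?_
    simp only [smul_smul, hBdef, ← biasedWeightDeriv_eq hs hs1]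
    exact sum_biasedWeightDeriv_smul s i (fun _ => v i) fun _ => rfl
  have h1 : ∑ r, B r * ‖U r‖ ≤ ∑ r, ∑ r', B r * B r' * ‖U r - U r'‖ := by
    refine Finset.sum_le_sum fun r _ => ?_
    have e : U r = ∑ r', B r' • (U r - U r') := by
      simp only [smul_sub, Finset.sum_sub_distrib]
      rw [hmean, ← Finset.sum_smul, hB1, one_smul, sub_zero]
    have h2 : ‖U r‖ ≤ ∑ r', B r' * ‖U r - U r'‖ := by
      calc ‖U r‖ = ‖∑ r', B r' • (U r - U r')‖ := by rw [← e]
        _ ≤ ∑ r', ‖B r' • (U r - U r')‖ := norm_sum_le _ _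
        _ = _ := Finset.sum_congr rfl fun r' _ => by
          rw [norm_smul, Real.norm_of_nonneg (hB r')]
    calc B r * ‖U r‖ ≤ B r * ∑ r', B r' * ‖U r - U r'‖ := by gcongr; exact hB r
      _ = _ := by rw [Finset.mul_sum]; simp only [mul_assoc]
  have h2 : ∀ δ : Fin n → Bool, ∑ r, ∑ r', B r * B r' * ‖U r - U r'‖ =
      ∑ r, ∑ r', B r * B r' *
        ‖∑ i, sgn (δ i) • (scoreB s (r i) • v i + (-1 : ℝ) • scoreB s (r' i) • v i)‖ := by
    intro δ
    rw [← sum_mixc _ δ (fun r r' => ‖∑ i, sgn (δ i) •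
      (scoreB s (r i) • v i + (-1 : ℝ) • scoreB s (r' i) • v i)‖)]
    refine Finset.sum_congr rfl fun r _ => Finset.sum_congr rfl fun r' _ => ?_
    congr 1
    rw [hU, ← Finset.sum_sub_distrib, ← norm_neg, ← Finset.sum_neg_distrib]
    refine congrArg _ (Finset.sum_congr rfl fun i _ => ?_)
    unfold mixc
    cases δ i
    · simp only [sgn, Bool.false_eq_true, if_false]; module
    · simp only [sgn, if_true]; module
  have h3 : ∑ r, ∑ r', B r * B r' * ‖U r - U r'‖ = ∑ r, ∑ r', B r * B r' *
      radAvg (fun i => scoreB s (r i) • v i + (-1 : ℝ) • scoreB s (r' i) • v i) := by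
    have h2' := Finset.sum_congr rfl fun δ (_ : δ ∈ (univ : Finset (Fin n → Bool))) => h2 δ
    rw [Finset.sum_const, Finset.card_univ, nsmul_eq_mul] at h2'
    have h4 : ∑ r, ∑ r', B r * B r' * ‖U r - U r'‖ = (2 ^ n : ℝ)⁻¹ *
        ((Fintype.card (Fin n → Bool) : ℝ) * ∑ r, ∑ r', B r * B r' * ‖U r - U r'‖) := by
      simp
    rw [h4, h2', Finset.sum_comm, Finset.mul_sum]
    refine Finset.sum_congr rfl fun r _ => ?_
    rw [Finset.sum_comm, Finset.mul_sum]
    refine Finset.sum_congr rfl fun r' _ => ?_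
    rw [← Finset.mul_sum, radAvg]; ring
  rw [h3] at h1
  refine h1.trans ?_
  calc _ ≤ ∑ r, ∑ r', B r * B r' * (radAvg (fun i => scoreB s (r i) • v i) +
        radAvg (fun i => scoreB s (r' i) • v i)) := by
        refine Finset.sum_le_sum fun r _ => Finset.sum_le_sum fun r' _ =>
          mul_le_mul_of_nonneg_left ?_ (mul_nonneg (hB r) (hB r'))
        refine (radAvg_add_le _ _).trans (le_of_eq ?_)
        rw [radAvg_smul]; simp
    _ = _ := by
        simp only [mul_add, Finset.sum_add_distrib]
        rw [two_mul]
        congr 1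
        · refine Finset.sum_congr rfl fun r _ => ?_
          rw [← Finset.sum_mul, ← Finset.mul_sum, hB1, mul_one]
        · rw [Finset.sum_comm]
          refine Finset.sum_congr rfl fun r _ => ?_
          rw [← Finset.sum_mul, ← Finset.sum_mul, hB1, one_mul]

end

theorem sum_score_norm_le {q Cq K : ℝ} (hq : 1 ≤ q) (hCq : 0 < Cq) (hK : 0 < K)
    {X : Type} [NormedAddCommGroup X] [NormedSpace ℝ X]
    (hX : CotypeC X q Cq)
    (hkah : ∀ (n : ℕ) (v : Fin n → X),
      (2 ^ n : ℝ)⁻¹ * ∑ δ : Fin n → Bool, ‖∑ i, sgn (δ i) • v i‖ ^ q ≤ K * radAvg v ^ q)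
    {n : ℕ} {s : ℝ} (hs : 0 < s) (hs1 : s < 1) (v : Fin n → X) :
    ∑ r, biasedWeight (fun _ : Fin n => s) r * ‖∑ i, scoreB s (r i) • v i‖ ≤
      4 * (Cq * K ^ (1 / q)) * (s ^ (1 / q - 1) + (1 - s) ^ (1 / q - 1)) * radAvg v := by
  have hs2 : 0 < 1 - s := by linarith
  have h1 := sum_biasedWeight_radAvg_select_le hq hCq hK hX hkah hs hs1 v
  have h2 := sum_biasedWeight_radAvg_select_le hq hCq hK hX hkah hs2 (by linarith) v
  rw [← sum_biasedWeight_not] at h2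
  have h3 : ∀ r : Fin n → Bool, radAvg (fun i => scoreB s (r i) • v i) ≤
      s⁻¹ * radAvg (fun i => if r i = true then v i else 0) +
        (1 - s)⁻¹ * radAvg (fun i => if (!(r i)) = true then v i else 0) := by
    intro r
    have e : (fun i => scoreB s (r i) • v i) = fun i =>
        s⁻¹ • (if r i = true then v i else 0) +
          (-(1 - s)⁻¹) • (if (!(r i)) = true then v i else 0) := by
      funext i
      cases r i <;> simp [scoreB]
    rw [e]
    refine (radAvg_add_le _ _).trans (le_of_eq ?_)
    rw [radAvg_smul, radAvg_smul, abs_neg, abs_of_pos (inv_pos.2 hs), abs_of_pos (inv_pos.2 hs2)]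
  have h4 := sum_score_norm_le_radAvg hs hs1 v
  refine h4.trans ?_
  calc _ ≤ 2 * ∑ r, biasedWeight (fun _ : Fin n => s) r *
        (s⁻¹ * radAvg (fun i => if r i = true then v i else 0) +
        (1 - s)⁻¹ * radAvg (fun i => if (!(r i)) = true then v i else 0)) := by
        gcongr with r
        · exact biasedWeight_nonneg hs.le hs1.le r
        · exact h3 r
    _ = 2 * (s⁻¹ * ∑ r, biasedWeight (fun _ : Fin n => s) r *
          radAvg (fun i => if r i = true then v i else 0) +
        (1 - s)⁻¹ * ∑ r, biasedWeight (fun _ : Fin n => s) r *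
          radAvg (fun i => if (!(r i)) = true then v i else 0)) := by
        simp only [mul_add, Finset.sum_add_distrib, Finset.mul_sum]
        congr 1 <;> exact Finset.sum_congr rfl fun r _ => by ring
    _ ≤ 2 * (s⁻¹ * (2 * (Cq * K ^ (1 / q)) * s ^ (1 / q) * radAvg v) +
        (1 - s)⁻¹ * (2 * (Cq * K ^ (1 / q)) * (1 - s) ^ (1 / q) * radAvg v)) := by
        gcongr
    _ = _ := by
        rw [Real.rpow_sub_one hs.ne', Real.rpow_sub_one hs2.ne']
        ring

theorem bder_mean_mixc {X : Type*} [AddCommGroup X] [Module ℝ X] {n : ℕ} (α : ℝ)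
    (f : (Fin n → Bool) → X) (x z r : Fin n → Bool) (i : Fin n) :
    f (mixc (flipc r i) x z) - bder α i f (mixc (flipc r i) x z) =
      f (mixc r x z) - bder α i f (mixc r x z) := by
  have h : ∀ b, Function.update (mixc (flipc r i) x z) i b =
      Function.update (mixc r x z) i b := by
    intro b; funext j
    by_cases hj : j = i
    · subst hj; simp
    · simp [hj, mixc, flipc]
  simp only [bder, h]
  abel

theorem sum_biasedWeightDeriv_smul_mixc {X : Type*} [AddCommGroup X] [Module ℝ X] {n : ℕ}
    {s : ℝ} (hs : 0 < s) (hs1 : s < 1) (α : ℝ)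
    (f : (Fin n → Bool) → X) (x z : Fin n → Bool) :
    ∑ r, (∑ i, biasedWeightDeriv s r i) • f (mixc r x z) =
      ∑ r, biasedWeight (fun _ : Fin n => s) r •
        ∑ i, scoreB s (r i) • bder α i f (mixc r x z) := by
  simp only [Finset.sum_smul, Finset.smul_sum, smul_smul, ← biasedWeightDeriv_eq hs hs1]
  rw [Finset.sum_comm, Finset.sum_comm (s := univ) (t := univ) (f := fun r i =>
    biasedWeightDeriv s r i • bder α i f (mixc r x z)), ← sub_eq_zero, ← Finset.sum_sub_distrib]
  refine Finset.sum_eq_zero fun i _ => ?_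
  rw [← Finset.sum_sub_distrib]
  simp only [← smul_sub]
  exact sum_biasedWeightDeriv_smul s i (fun r => f (mixc r x z) - bder α i f (mixc r x z))
    fun r => bder_mean_mixc α f x z r i

theorem sum_biasedWeight_zero {n : ℕ} (G : (Fin n → Bool) → ℝ) :
    ∑ r, biasedWeight (fun _ : Fin n => 0) r * G r = G (fun _ => false) := by
  rw [Finset.sum_eq_single (fun _ => false)]
  · simp [biasedWeight]
  · intro r _ hr
    obtain ⟨i, hi⟩ := Function.ne_iff.1 hr
    have : biasedWeight (fun _ : Fin n => 0) r = 0 :=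
      Finset.prod_eq_zero (Finset.mem_univ i) (by simpa using hi)
    rw [this, zero_mul]
  · simp

theorem sum_biasedWeight_one {n : ℕ} (G : (Fin n → Bool) → ℝ) :
    ∑ r, biasedWeight (fun _ : Fin n => 1) r * G r = G (fun _ => true) := by
  have h := sum_biasedWeight_not 0 G
  rw [sum_biasedWeight_zero (fun r => G fun i => !(r i)), sub_zero] at h
  simpa using h.symm

/-- The biased Pisier inequality in `L_1` for spaces of nontrivial cotype. -/
theorem sum_norm_sub_mean_le {q Cq K : ℝ} (hq : 1 ≤ q) (hCq : 0 < Cq) (hK : 0 < K)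
    {X : Type} [NormedAddCommGroup X] [NormedSpace ℝ X]
    (hX : CotypeC X q Cq)
    (hkah : ∀ (n : ℕ) (v : Fin n → X),
      (2 ^ n : ℝ)⁻¹ * ∑ δ : Fin n → Bool, ‖∑ i, sgn (δ i) • v i‖ ^ q ≤ K * radAvg v ^ q)
    {n : ℕ} {α : ℝ} (hα : 0 ≤ α) (hα1 : α ≤ 1) (f : (Fin n → Bool) → X) :
    ∑ x, biasedWeight (fun _ : Fin n => α) x *
        ‖f x - ∑ y, biasedWeight (fun _ : Fin n => α) y • f y‖ ≤
      8 * (Cq * K ^ (1 / q)) * q * ∑ y, biasedWeight (fun _ : Fin n => α) y *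
        radAvg (fun i => bder α i f y) := by
  have hμ : ∀ x, 0 ≤ biasedWeight (fun _ : Fin n => α) x := biasedWeight_nonneg hα hα1
  have hμ1 := sum_biasedWeight n α
  have hmix := fun r Ψ => sum_mixc_fst (n := n) α r Ψ
  set μ := biasedWeight (fun _ : Fin n => α) with hμdef
  set m := ∑ y, μ y • f y with hm
  set D := ∑ y, μ y * radAvg (fun i => bder α i f y) with hD
  have hD0 : 0 ≤ D := Finset.sum_nonneg fun y _ => mul_nonneg (hμ y) (radAvg_nonneg _)
  set c := 4 * (Cq * K ^ (1 / q)) with hc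
  have hc0 : 0 ≤ c := by positivity
  have hq0 : 0 < q := by linarith
  choose φ hφ1 hφ using fun x => exists_dual_vector'' ℝ (f x - m)
  have hle : ∀ x z, |φ x z| ≤ ‖z‖ := fun x z =>
    ((φ x).le_opNorm z).trans (mul_le_of_le_one_left (norm_nonneg z) (hφ1 x))
  set H : (Fin n → Bool) → ℝ := fun r => ∑ x, ∑ z, μ x * μ z * φ x (f (mixc r x z)) with hH
  set h : ℝ → ℝ := fun s => ∑ r, biasedWeight (fun _ : Fin n => s) r * H r with hh
  have hderiv : ∀ s, HasDerivAt h (∑ r, (∑ i, biasedWeightDeriv s r i) * H r) s := fun s =>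
    HasDerivAt.fun_sum fun r _ => (hasDerivAt_biasedWeight r s).mul_const _
  have hdiff : h 0 - h 1 = ∑ x, μ x * ‖f x - m‖ := by
    simp only [hh]
    rw [sum_biasedWeight_zero, sum_biasedWeight_one]
    simp only [hH]
    rw [← Finset.sum_sub_distrib]
    refine Finset.sum_congr rfl fun x _ => ?_
    have e1 : ∑ z, μ x * μ z * φ x (f x) = μ x * φ x (f x) := by
      rw [← Finset.sum_mul, ← Finset.mul_sum, hμ1, mul_one]
    have e2 : ∑ z, μ x * μ z * φ x (f z) = μ x * φ x m := by
      rw [hm, map_sum, Finset.mul_sum]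
      refine Finset.sum_congr rfl fun z _ => ?_
      rw [map_smul, smul_eq_mul]; ring
    have e3 : φ x (f x - m) = ‖f x - m‖ := hφ x
    rw [← e3, map_sub]
    change ∑ z, μ x * μ z * φ x (f x) - ∑ z, μ x * μ z * φ x (f z) = _
    rw [e1, e2]; ring
  have hbound : ∀ s, 0 < s → s < 1 →
      -(∑ r, (∑ i, biasedWeightDeriv s r i) * H r) ≤
        c * (s ^ (1 / q - 1) + (1 - s) ^ (1 / q - 1)) * D := by
    intro s hs hs1
    have hB : ∀ r, 0 ≤ biasedWeight (fun _ : Fin n => s) r := biasedWeight_nonneg hs.le hs1.le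
    have e1 : ∑ r, (∑ i, biasedWeightDeriv s r i) * H r =
        ∑ x, ∑ z, μ x * μ z * φ x (∑ r, biasedWeight (fun _ : Fin n => s) r •
          ∑ i, scoreB s (r i) • bder α i f (mixc r x z)) := by
      simp only [hH, ← sum_biasedWeightDeriv_smul_mixc hs hs1, map_sum, Finset.mul_sum,
        map_smul, smul_eq_mul]
      rw [Finset.sum_comm]
      refine Finset.sum_congr rfl fun x _ => ?_
      rw [Finset.sum_comm]
      refine Finset.sum_congr rfl fun z _ => Finset.sum_congr rfl fun r _ => ?_
      ring
    have e2 : -(∑ r, (∑ i, biasedWeightDeriv s r i) * H r) ≤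
        ∑ x, ∑ z, μ x * μ z * ∑ r, biasedWeight (fun _ : Fin n => s) r *
          ‖∑ i, scoreB s (r i) • bder α i f (mixc r x z)‖ := by
      rw [e1, ← Finset.sum_neg_distrib]
      refine Finset.sum_le_sum fun x _ => ?_
      rw [← Finset.sum_neg_distrib]
      refine Finset.sum_le_sum fun z _ => ?_
      rw [← mul_neg]
      refine mul_le_mul_of_nonneg_left ?_ (mul_nonneg (hμ x) (hμ z))
      refine (neg_le_abs _).trans ((hle x _).trans ((norm_sum_le _ _).trans (le_of_eq ?_)))
      refine Finset.sum_congr rfl fun r _ => ?_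
      rw [norm_smul, Real.norm_of_nonneg (hB r)]
    have e3 : ∑ x, ∑ z, μ x * μ z * ∑ r, biasedWeight (fun _ : Fin n => s) r *
          ‖∑ i, scoreB s (r i) • bder α i f (mixc r x z)‖ =
        ∑ y, μ y * ∑ r, biasedWeight (fun _ : Fin n => s) r *
          ‖∑ i, scoreB s (r i) • bder α i f y‖ := by
      have e4 : ∀ r, ∑ x, ∑ z, μ x * μ z * (biasedWeight (fun _ : Fin n => s) r *
          ‖∑ i, scoreB s (r i) • bder α i f (mixc r x z)‖) =
          ∑ y, μ y * (biasedWeight (fun _ : Fin n => s) r *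
            ‖∑ i, scoreB s (r i) • bder α i f y‖) := fun r =>
        hmix r (fun y => biasedWeight (fun _ : Fin n => s) r *
            ‖∑ i, scoreB s (r i) • bder α i f y‖)
      simp only [Finset.mul_sum]
      rw [Finset.sum_comm (s := univ) (t := univ) (f := fun y r =>
        μ y * (biasedWeight (fun _ : Fin n => s) r * ‖∑ i, scoreB s (r i) • bder α i f y‖))]
      simp only [← e4]
      rw [Finset.sum_comm (s := univ) (t := univ) (f := fun r x => ∑ z, μ x * μ z *
        (biasedWeight (fun _ : Fin n => s) r *
          ‖∑ i, scoreB s (r i) • bder α i f (mixc r x z)‖))]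
      refine Finset.sum_congr rfl fun x _ => ?_
      rw [Finset.sum_comm]
    rw [e3] at e2
    refine e2.trans ?_
    rw [hD, Finset.mul_sum]
    refine Finset.sum_le_sum fun y _ => ?_
    rw [mul_left_comm]
    exact mul_le_mul_of_nonneg_left (sum_score_norm_le hq hCq hK hX hkah hs hs1 _) (hμ y)
  have hmono : MonotoneOn (fun s => h s + c * q * D * (s ^ (1 / q) - (1 - s) ^ (1 / q)))
      (Set.Icc 0 1) := by
    have hq1 : 0 ≤ 1 / q := by positivity
    refine monotoneOn_of_hasDerivWithinAt_nonneg (convex_Icc 0 1)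
      (f' := fun s => (∑ r, (∑ i, biasedWeightDeriv s r i) * H r) + c * q * D *
        (1 / q * s ^ (1 / q - 1) - -(1 / q * (1 - s) ^ (1 / q - 1)))) ?_ ?_ ?_
    · refine ContinuousOn.add (fun s _ => (hderiv s).continuousAt.continuousWithinAt) ?_
      refine ContinuousOn.mul continuousOn_const (ContinuousOn.sub ?_ ?_)
      · exact continuousOn_id.rpow_const fun s _ => Or.inr hq1
      · exact (continuousOn_const.sub continuousOn_id).rpow_const fun s _ => Or.inr hq1
    · rw [interior_Icc]
      intro s hs
      refine HasDerivAt.hasDerivWithinAt ((hderiv s).add (HasDerivAt.const_mul _ ?_))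
      refine (Real.hasDerivAt_rpow_const (Or.inl hs.1.ne')).sub ?_
      have := ((hasDerivAt_id' s).const_sub 1).rpow_const (p := 1 / q)
        (Or.inl (by have := hs.2; linarith))
      rw [show -1 * (1 / q) * (1 - s) ^ (1 / q - 1) = -(1 / q * (1 - s) ^ (1 / q - 1)) by ring]
        at this
      exact this
    · rw [interior_Icc]
      intro s hs
      have := hbound s hs.1 hs.2
      have e : c * q * D * (1 / q * s ^ (1 / q - 1) - -(1 / q * (1 - s) ^ (1 / q - 1))) =
        c * (s ^ (1 / q - 1) + (1 - s) ^ (1 / q - 1)) * D := by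
        field_simp; ring
      simp only [e]
      linarith
  have hfin := hmono (Set.left_mem_Icc.2 zero_le_one) (Set.right_mem_Icc.2 zero_le_one) zero_le_one
  have hq2 : 1 / q ≠ 0 := by positivity
  simp only [sub_zero, sub_self, Real.zero_rpow hq2, Real.one_rpow] at hfin
  rw [← hdiff]
  linarith

theorem sum_radAvg_bder_rpow_le {X : Type*} [NormedAddCommGroup X] [NormedSpace ℝ X] {n : ℕ}
    {α p : ℝ} (hα : 0 ≤ α) (hα1 : α ≤ 1) (hp : 1 ≤ p) (f : (Fin n → Bool) → X) :
    ∑ x, biasedWeight (fun _ : Fin n => α) x * radAvg (fun i => bder α i f x) ^ p ≤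
      (2 ^ n : ℝ)⁻¹ * ∑ δ : Fin n → Bool, lpNormW (biasedWeight fun _ : Fin n => α) p
        (fun x => ∑ i, sgn (δ i) • bder α i f x) ^ p := by
  have hμ : ∀ x, 0 ≤ biasedWeight (fun _ : Fin n => α) x := biasedWeight_nonneg hα hα1
  have h1 : ∀ δ : Fin n → Bool, lpNormW (biasedWeight fun _ : Fin n => α) p
      (fun x => ∑ i, sgn (δ i) • bder α i f x) ^ p =
      ∑ x, biasedWeight (fun _ : Fin n => α) x * ‖∑ i, sgn (δ i) • bder α i f x‖ ^ p := by
    intro δ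
    rw [lpNormW, ← Real.rpow_mul (Finset.sum_nonneg fun x _ =>
      mul_nonneg (hμ x) (by positivity)), one_div_mul_cancel (by linarith), Real.rpow_one]
  simp only [h1]
  rw [Finset.sum_comm, Finset.mul_sum]
  refine Finset.sum_le_sum fun x _ => ?_
  rw [← Finset.mul_sum, mul_left_comm]
  exact mul_le_mul_of_nonneg_left (rpow_radAvg_le hp _) (hμ x)

theorem bder_smul_sub_const {ι : Type*} [DecidableEq ι] {X : Type*} [AddCommGroup X] [Module ℝ X]
    (α : ℝ) (i : ι) (f : (ι → Bool) → X) (c : ℝ) (m : X) (x : ι → Bool) :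
    bder α i (fun y => c • (f y - m)) x = c • bder α i f x := by
  unfold bder
  module

theorem orliczNormW_le_of_sum_le {n : ℕ} {α p L γ : ℝ} (hα : 0 ≤ α) (hα1 : α ≤ 1) (hp : 1 ≤ p)
    (hL : 1 ≤ L) (hγ : 0 < γ) {X : Type*} [NormedAddCommGroup X] (g : (Fin n → Bool) → X)
    (h : ∑ x, biasedWeight (fun _ : Fin n => α) x * ((L / γ * ‖g x‖) ^ p *
      Real.log (Real.exp 1 + (L / γ * ‖g x‖) ^ p) ^ (p / 2)) ≤ L) :
    orliczNormW (biasedWeight fun _ : Fin n => α) p g ≤ γ := by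
  have hμ : ∀ x, 0 ≤ biasedWeight (fun _ : Fin n => α) x := biasedWeight_nonneg hα hα1
  refine csInf_le ⟨0, fun _ hz => hz.1.le⟩ ⟨hγ, ?_⟩
  have hL0 : 0 < L := by linarith
  refine le_of_mul_le_mul_left ?_ hL0
  rw [mul_one, Finset.mul_sum]
  refine le_trans (Finset.sum_le_sum fun x _ => ?_) h
  have e : (L / γ * ‖g x‖) ^ p = L ^ p * (‖g x‖ ^ p / γ ^ p) := by
    rw [← Real.div_rpow (norm_nonneg _) hγ.le, ← Real.mul_rpow hL0.le (by positivity)]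
    congr 1; ring
  have hLp : L ≤ L ^ p := by
    simpa using Real.rpow_le_rpow_of_exponent_le hL hp
  rw [e]
  have ht : 0 ≤ ‖g x‖ ^ p / γ ^ p := by positivity
  generalize ‖g x‖ ^ p / γ ^ p = t at ht
  have h1 : L * t ≤ L ^ p * t := by gcongr
  have h2 : t ≤ L ^ p * t := le_mul_of_one_le_left ht (hL.trans hLp)
  have h3 : 0 ≤ Real.log (Real.exp 1 + t) := by
    apply Real.log_nonneg
    have := Real.add_one_le_exp (1 : ℝ)
    linarith
  have h4 : Real.log (Real.exp 1 + t) ≤ Real.log (Real.exp 1 + L ^ p * t) := by gcongr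
  calc L * (biasedWeight (fun _ : Fin n => α) x * t * Real.log (Real.exp 1 + t) ^ (p / 2))
      = biasedWeight (fun _ : Fin n => α) x *
          (L * t * Real.log (Real.exp 1 + t) ^ (p / 2)) := by ring
    _ ≤ _ := by
      refine mul_le_mul_of_nonneg_left ?_ (hμ x)
      gcongr

/-- Biased Pisier--Talagrand inequality without the `log n` term,
for normed spaces of cotype `q` with constant `Cq`. -/
theorem stmt2 (p α q Cq : ℝ) (hp : 1 ≤ p) (hα0 : 0 < α) (hα1 : α < 1)
    (hq : 2 ≤ q) (hCq : 0 < Cq) :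
    ∃ K : ℝ, 0 < K ∧
      ∀ (X : Type) [NormedAddCommGroup X] [NormedSpace ℝ X],
      CotypeC X q Cq →
      ∀ (n : ℕ) (f : (Fin n → Bool) → X),
      orliczNormW (biasedWeight fun _ : Fin n => α) p
          (fun x => f x - ∑ y : Fin n → Bool, biasedWeight (fun _ : Fin n => α) y • f y) ≤
        K * ((2 ^ n : ℝ)⁻¹ * ∑ δ : Fin n → Bool,
            lpNormW (biasedWeight fun _ : Fin n => α) p
              (fun x => ∑ i, sgn (δ i) • bder α i f x) ^ p) ^ (1 / p) := by
  have hq1 : 1 ≤ q := by linarith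
  obtain ⟨κ, hκ, hkah⟩ := exists_kahane hq1
  obtain ⟨B, hB1, hB⟩ := exists_bound_sum_rpow_mul_log hα0 hα1 hp
  set C₁ := 8 * (Cq * κ ^ (1 / q)) * q with hC₁
  set M := 3 * max (1 - α)⁻¹ α⁻¹ with hM
  have hC₁0 : 0 < C₁ := by positivity
  have hM0 : 0 < M := mul_pos (by norm_num) (lt_max_of_lt_right (inv_pos.2 hα0))
  have hB0 : 0 < B := by linarith
  refine ⟨B * (C₁ + M), by positivity, fun X _ _ hX n f => ?_⟩
  have hμ : ∀ x, 0 ≤ biasedWeight (fun _ : Fin n => α) x := biasedWeight_nonneg hα0.le hα1.le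
  have hp0 : 0 < p := by linarith
  have hpis := sum_norm_sub_mean_le hq1 hCq hκ hX (hkah X) hα0.le hα1.le f
  have hR := sum_radAvg_bder_rpow_le hα0.le hα1.le hp f
  rw [← hC₁] at hpis
  set S := (2 ^ n : ℝ)⁻¹ * ∑ δ : Fin n → Bool, lpNormW (biasedWeight fun _ : Fin n => α) p
        (fun x => ∑ i, sgn (δ i) • bder α i f x) ^ p
  set m := ∑ y : Fin n → Bool, biasedWeight (fun _ : Fin n => α) y • f y
  have hRnn : ∀ x, 0 ≤ radAvg (fun i => bder α i f x) := fun x => radAvg_nonneg _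
  have hS0 : 0 ≤ S := le_trans (Finset.sum_nonneg fun x _ =>
    mul_nonneg (hμ x) (Real.rpow_nonneg (hRnn x) _)) hR
  have hR1 : ∑ x, biasedWeight (fun _ : Fin n => α) x * radAvg (fun i => bder α i f x) ≤
      S ^ (1 / p) := by
    have h := (Real.rpow_arith_mean_le_arith_mean_rpow univ _ _ (fun x _ => hμ x)
      (sum_biasedWeight n α) (fun x _ => hRnn x) hp).trans hR
    have h0 : 0 ≤ ∑ x, biasedWeight (fun _ : Fin n => α) x * radAvg (fun i => bder α i f x) :=
      Finset.sum_nonneg fun x _ => mul_nonneg (hμ x) (hRnn x)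
    rw [one_div]
    exact (Real.le_rpow_inv_iff_of_pos h0 hS0 hp0).2 h
  have hSD : S = (S ^ (1 / p)) ^ p := by
    rw [← Real.rpow_mul hS0, one_div_mul_cancel hp0.ne', Real.rpow_one]
  have hD0 : 0 ≤ S ^ (1 / p) := by positivity
  set D := S ^ (1 / p)
  refine le_of_forall_gt_imp_ge_of_dense fun γ hγ => ?_
  have hγ0 : 0 < γ := lt_of_le_of_lt (by positivity) hγ
  have hc0 : 0 < B / γ := by positivity
  have hBC : B / γ * (C₁ * D) ≤ 1 := by
    rw [div_mul_eq_mul_div, div_le_one hγ0]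
    have : 0 ≤ B * M * D := by positivity
    linarith
  have hBM : B / γ * M * D ≤ 1 := by
    rw [div_mul_eq_mul_div, div_mul_eq_mul_div, div_le_one hγ0]
    have : 0 ≤ B * C₁ * D := by positivity
    linarith
  refine orliczNormW_le_of_sum_le hα0.le hα1.le hp hB1 hγ0 _ ?_
  have hnorm : ∀ x, B / γ * ‖f x - m‖ = ‖(B / γ) • (f x - m)‖ := fun x => by
    rw [norm_smul, Real.norm_of_nonneg hc0.le]
  refine hB n (fun x => B / γ * ‖f x - m‖) (fun x => by positivity) ?_ ?_
  · simp only [mul_left_comm _ (B / γ)]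
    rw [← Finset.mul_sum]
    refine le_trans ?_ hBC
    gcongr
    exact hpis.trans (by gcongr)
  · have hmg : ∀ x, mgrad (fun x => B / γ * ‖f x - m‖) x ≤
        B / γ * M * radAvg (fun i => bder α i f x) := by
      intro x
      simp only [hnorm]
      refine (mgrad_norm_le_bder hα0 hα1 (fun y => (B / γ) • (f y - m)) x).trans (le_of_eq ?_)
      simp only [bder_smul_sub_const]
      rw [radAvg_smul, abs_of_pos hc0]; ring
    have hBM0 : 0 ≤ B / γ * M := by positivity
    calc _ ≤ ∑ x, biasedWeight (fun _ : Fin n => α) x *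
          (B / γ * M * radAvg (fun i => bder α i f x)) ^ p :=
          Finset.sum_le_sum fun x _ => mul_le_mul_of_nonneg_left
            (Real.rpow_le_rpow (mgrad_nonneg _ _) (hmg x) hp0.le) (hμ x)
      _ = (B / γ * M) ^ p * ∑ x, biasedWeight (fun _ : Fin n => α) x *
          radAvg (fun i => bder α i f x) ^ p := by
          rw [Finset.mul_sum]
          refine Finset.sum_congr rfl fun x _ => ?_
          rw [Real.mul_rpow hBM0 (hRnn x)]; ring
      _ ≤ (B / γ * M) ^ p * D ^ p := by
          rw [← hSD]; gcongr
      _ = (B / γ * M * D) ^ p := (Real.mul_rpow hBM0 hD0).symm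
      _ ≤ 1 := Real.rpow_le_one (by positivity) hBM hp0.le
end
end

section
/- For every p ∈ (1,2) there exists a constant c_p ∈ (0,∞), depending only on p, with the following property. Let X be a real Banach space and C ∈ (0,∞) be such that for every n ∈ ℕ and all vectors v_1,…,v_n ∈ X one has ∫_{{-1,1}^n} ‖Σ_{i=1}^n x_i v_i‖_X^p dσ_n(x) ≤ C^p · ‖(‖v_1‖_X,…,‖v_n‖_X)‖_{ℓ_{p,∞}^n}^p. Then X has metric stable type p with constant c_p · C. -/
open Finset

noncomputable section

theorem sum_biasedWeight_mul_prod {ι : Type*} [Fintype ι] [DecidableEq ι] (q : ℝ)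
    (h : ι → Bool → ℝ) :
    ∑ B : ι → Bool, biasedWeight (fun _ => q) B * ∏ i, h i (B i) =
      ∏ i, (q * h i true + (1 - q) * h i false) := by
  have key := Finset.prod_univ_sum (fun _ : ι => (Finset.univ : Finset Bool))
    (fun i b => (if b then q else 1 - q) * h i b)
  simp only [Fintype.sum_bool, Fintype.piFinset_univ, if_true, Bool.false_eq_true, if_false] at key
  rw [key]
  simp only [biasedWeight, Finset.prod_mul_distrib]

theorem sum_biasedWeight_s4 {ι : Type*} [Fintype ι] [DecidableEq ι] (q : ℝ) :
    ∑ B : ι → Bool, biasedWeight (fun _ => q) B = 1 := by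
  simpa using sum_biasedWeight_mul_prod (ι := ι) q (fun _ _ => 1)

theorem biasedWeight_nonneg_s4 {ι : Type*} [Fintype ι] {q : ℝ} (h0 : 0 ≤ q) (h1 : q ≤ 1)
    (B : ι → Bool) : 0 ≤ biasedWeight (fun _ => q) B := by
  refine Finset.prod_nonneg fun i _ => ?_
  split_ifs <;> linarith

/-- The centred indicator of the event that a coordinate is selected. -/
def centred (q : ℝ) (b : Bool) : ℝ := (if b then 1 else 0) - q

theorem sum_biasedWeight_mul_centred {ι : Type*} [Fintype ι] [DecidableEq ι] (q : ℝ) (i j : ι) :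
    ∑ B : ι → Bool, biasedWeight (fun _ => q) B * (centred q (B i) * centred q (B j)) =
      if i = j then q * (1 - q) else 0 := by
  have key := sum_biasedWeight_mul_prod q
    (fun k b => (if k = i then centred q b else 1) * (if k = j then centred q b else 1))
  simp only [Finset.prod_mul_distrib, Finset.prod_ite_eq', Finset.mem_univ, if_true] at key
  rw [key]
  split_ifs with hij
  · subst hij
    rw [Finset.prod_eq_single i]
    · simp [centred]; ring
    · intro k _ hk; simp [hk]
    · simp
  · refine Finset.prod_eq_zero (Finset.mem_univ i) ?_
    simp [hij, centred]; ring

theorem sum_biasedWeight_mul_sq {ι : Type*} [Fintype ι] [DecidableEq ι] (q : ℝ) (A : Finset ι) :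
    ∑ B : ι → Bool, biasedWeight (fun _ => q) B * (∑ i ∈ A, centred q (B i)) ^ 2 =
      A.card * (q * (1 - q)) := by
  simp_rw [sq, Finset.sum_mul_sum]
  simp_rw [Finset.mul_sum]
  rw [Finset.sum_comm]
  have (i : ι) (hi : i ∈ A) : ∑ B : ι → Bool, ∑ j ∈ A,
      biasedWeight (fun _ => q) B * (centred q (B i) * centred q (B j)) = q * (1 - q) := by
    rw [Finset.sum_comm]
    simp_rw [sum_biasedWeight_mul_centred]
    simp [hi]
  rw [Finset.sum_congr rfl this]
  simp

/-- A random selection of coordinates with small probability decreases the weak `ℓ_1` norm in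
mean. -/
theorem exists_majorant_selection {ι : Type*} [Fintype ι] [DecidableEq ι] {q W : ℝ}
    (h0 : 0 ≤ q) (h1 : q ≤ 1) (hW : 0 ≤ W) (u : ι → ℝ)
    (hu : ∀ r : ℝ, 0 < r → r * ((Finset.univ.filter fun i => r ≤ u i).card : ℝ) ≤ W) :
    ∃ Z : (ι → Bool) → ℝ, (∀ B, 0 ≤ Z B) ∧
      (∀ B, ∀ r : ℝ, 0 < r →
        r * ((Finset.univ.filter fun i => B i = true ∧ r ≤ u i).card : ℝ) ≤ Z B) ∧
      ∑ B : ι → Bool, biasedWeight (fun _ => q) B * Z B ≤ 6 * W * √q := by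
  rcases hW.eq_or_lt with rfl | hW
  · refine ⟨0, fun B => le_rfl, fun B r hr => ?_, by simp⟩
    refine le_trans ?_ (hu r hr)
    gcongr
    exact fun h => h.2
  obtain ⟨J, hJ⟩ : ∃ J : ℕ, ∀ i, 0 < u i → W * (1 / 2) ^ J ≤ u i := by
    have (i : ι) : ∀ᶠ J : ℕ in Filter.atTop, 0 < u i → W * (1 / 2 : ℝ) ^ J ≤ u i := by
      by_cases hi : 0 < u i
      · have ht : Filter.Tendsto (fun J : ℕ => W * (1 / 2 : ℝ) ^ J) Filter.atTop (nhds (W * 0)) :=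
          (tendsto_pow_atTop_nhds_zero_of_lt_one (by norm_num) (by norm_num)).const_mul W
        rw [mul_zero] at ht
        filter_upwards [ht.eventually_lt_const hi] with J hJ _ using hJ.le
      · exact Filter.Eventually.of_forall fun J h => absurd h hi
    exact (Filter.eventually_all.2 this).exists
  set A : ℕ → Finset ι := fun j => Finset.univ.filter fun i => W * (1 / 2 : ℝ) ^ j ≤ u i with hA
  have hcard (j : ℕ) : (1 / 2 : ℝ) ^ j * (A j).card ≤ 1 := by
    have := hu (W * (1 / 2) ^ j) (by positivity)
    rw [mul_assoc] at this
    exact le_of_mul_le_mul_left (by rwa [mul_one]) hW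
  set Y : (ι → Bool) → ℝ := fun B =>
    ∑ j ∈ Finset.range (J + 1), ((1 / 2 : ℝ) ^ j * ∑ i ∈ A j, centred q (B i)) ^ 2 with hY
  have hY0 (B) : 0 ≤ Y B := Finset.sum_nonneg fun j _ => sq_nonneg _
  have hlevel (B : ι → Bool) (j : ℕ) (hj : j ≤ J) :
      (1 / 2 : ℝ) ^ j * (((A j).filter fun i => B i = true).card : ℝ) ≤ q + √(Y B) := by
    have e : (((A j).filter fun i => B i = true).card : ℝ) =
        q * (A j).card + ∑ i ∈ A j, centred q (B i) := by
      simp [centred, Finset.sum_sub_distrib, mul_comm]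
    have l1 : (1 / 2 : ℝ) ^ j * ∑ i ∈ A j, centred q (B i) ≤ √(Y B) := by
      refine Real.le_sqrt_of_sq_le ?_
      exact Finset.single_le_sum
        (f := fun j => ((1 / 2 : ℝ) ^ j * ∑ i ∈ A j, centred q (B i)) ^ 2)
        (fun j _ => sq_nonneg _) (Finset.mem_range.2 (Nat.lt_succ_of_le hj))
    rw [e, mul_add]
    have := mul_le_mul_of_nonneg_left (hcard j) h0
    nlinarith
  have hmean : ∑ B : ι → Bool, biasedWeight (fun _ => q) B * √(Y B) ≤ √(2 * q) := by
    refine Real.le_sqrt_of_sq_le ?_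
    refine (Real.pow_arith_mean_le_arith_mean_pow _ _ _
      (fun B _ => biasedWeight_nonneg_s4 h0 h1 B) (sum_biasedWeight_s4 q)
      (fun B _ => Real.sqrt_nonneg _) 2).trans ?_
    simp_rw [Real.sq_sqrt (hY0 _), hY, mul_pow, Finset.mul_sum]
    rw [Finset.sum_comm]
    have hj (j : ℕ) : ∑ B : ι → Bool, biasedWeight (fun _ => q) B *
        (((1 / 2 : ℝ) ^ j) ^ 2 * (∑ i ∈ A j, centred q (B i)) ^ 2) ≤ (1 / 2 : ℝ) ^ j * q := by
      simp_rw [mul_left_comm _ (((1 / 2 : ℝ) ^ j) ^ 2)]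
      rw [← Finset.mul_sum, sum_biasedWeight_mul_sq]
      calc ((1 / 2 : ℝ) ^ j) ^ 2 * ((A j).card * (q * (1 - q)))
          = ((1 / 2 : ℝ) ^ j * (A j).card) * ((1 / 2 : ℝ) ^ j * (q * (1 - q))) := by ring
        _ ≤ 1 * ((1 / 2 : ℝ) ^ j * (q * 1)) := by
            gcongr
            · exact hcard j
            · linarith
        _ = _ := by ring
    refine (Finset.sum_le_sum fun j _ => hj j).trans ?_
    rw [← Finset.sum_mul]
    gcongr
    exact sum_geometric_two_le _
  refine ⟨fun B => 2 * W * (q + √(Y B)), fun B => by positivity, fun B r hr => ?_, ?_⟩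
  · rcases (Finset.univ.filter fun i => B i = true ∧ r ≤ u i).eq_empty_or_nonempty with h | ⟨i₀, hi₀⟩
    · rw [h]
      simpa using (by positivity : 0 ≤ 2 * W * (q + √(Y B)))
    obtain ⟨j, hj, hle, hsub⟩ : ∃ j ≤ J, r ≤ 2 * W * (1 / 2) ^ j ∧
        ∀ i, r ≤ u i → W * (1 / 2 : ℝ) ^ j ≤ u i := by
      rcases le_or_gt r (W * (1 / 2) ^ J) with h | h
      · refine ⟨J, le_rfl, h.trans ?_, fun i hi => hJ i (hr.trans_le hi)⟩
        gcongr
        linarith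
      · have hrW : r ≤ W := by
          have hne : (1 : ℝ) ≤ ((Finset.univ.filter fun i => r ≤ u i).card : ℝ) := by
            exact_mod_cast Finset.card_pos.2 ⟨i₀, by simpa using (Finset.mem_filter.1 hi₀).2.2⟩
          nlinarith [hu r hr]
        obtain ⟨k, hk1, hk2⟩ := exists_nat_pow_near_of_lt_one (div_pos hr hW)
          ((div_le_one hW).2 hrW) (by norm_num : (0 : ℝ) < 1 / 2) (by norm_num)
        rw [lt_div_iff₀ hW] at hk1
        rw [div_le_iff₀ hW] at hk2
        refine ⟨k + 1, ?_, ?_, fun i hi => by linarith⟩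
        · by_contra! hlt
          have : (1 / 2 : ℝ) ^ k ≤ (1 / 2) ^ J :=
            pow_le_pow_of_le_one (by norm_num) (by norm_num) (by omega)
          nlinarith
        · rw [pow_succ]
          linarith
    calc r * ((Finset.univ.filter fun i => B i = true ∧ r ≤ u i).card : ℝ)
        ≤ (2 * W * (1 / 2) ^ j) * (((A j).filter fun i => B i = true).card : ℝ) := by
          gcongr
          intro i hi
          simp only [Finset.mem_filter, Finset.mem_univ, true_and, hA] at hi ⊢
          exact ⟨hsub i hi.2, hi.1⟩
      _ = 2 * W * ((1 / 2) ^ j * (((A j).filter fun i => B i = true).card : ℝ)) := by ring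
      _ ≤ _ := mul_le_mul_of_nonneg_left (hlevel B j hj) (by positivity)
  · have hq : q ≤ √q := Real.le_sqrt_of_sq_le (by nlinarith)
    have h2 : √(2 * q) ≤ 2 * √q := by
      rw [Real.sqrt_mul (by norm_num)]
      gcongr
      exact (Real.sqrt_le_left (by norm_num)).2 (by norm_num)
    calc ∑ B : ι → Bool, biasedWeight (fun _ => q) B * (2 * W * (q + √(Y B)))
        = 2 * W * (q * ∑ B : ι → Bool, biasedWeight (fun _ => q) B +
            ∑ B : ι → Bool, biasedWeight (fun _ => q) B * √(Y B)) := by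
          simp only [Finset.mul_sum, ← Finset.sum_add_distrib]
          exact Finset.sum_congr rfl fun B _ => by ring
      _ ≤ 2 * W * (√q * 1 + 2 * √q) := by
          rw [sum_biasedWeight_s4]
          gcongr
          exact hmean.trans h2
      _ = _ := by ring

theorem weakLp_nonneg {ι : Type*} [Fintype ι] (p : ℝ) (w : ι → ℝ) : 0 ≤ weakLp p w := by
  refine Real.sSup_nonneg ?_
  rintro z ⟨r, hr, rfl⟩
  positivity

theorem rpow_mul_card_le_weakLp_rpow {ι : Type*} [Fintype ι] {p : ℝ} (hp : 0 < p) (w : ι → ℝ)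
    {r : ℝ} (hr : 0 ≤ r) :
    r ^ p * ((Finset.univ.filter fun i => r ≤ |w i|).card : ℝ) ≤ weakLp p w ^ p := by
  have hle : r * ((Finset.univ.filter fun i => r ≤ |w i|).card : ℝ) ^ (1 / p) ≤ weakLp p w := by
    refine le_csSup ⟨(∑ i, |w i|) * (Fintype.card ι : ℝ) ^ (1 / p), ?_⟩
      ⟨r, hr, by congr!⟩
    rintro z ⟨s, hs, rfl⟩
    rcases Finset.eq_empty_or_nonempty (Finset.univ.filter fun i => s ≤ |w i|) with h | ⟨i, hi⟩
    · have h0 : (0 : ℝ) ^ (1 / p) = 0 := Real.zero_rpow (by positivity)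
      have hc : (Finset.univ.filter fun i => s ≤ |w i|).card = 0 := by rw [h]; rfl
      have hz : s * ((Finset.univ.filter fun i => s ≤ |w i|).card : ℝ) ^ (1 / p) = 0 := by
        rw [hc, Nat.cast_zero, h0, mul_zero]
      refine le_of_eq_of_le (b := 0) ?_ (by positivity)
      convert hz
    · gcongr
      · exact (Finset.mem_filter.1 hi).2.trans
          (Finset.single_le_sum (f := fun i => |w i|) (fun _ _ => abs_nonneg _) (Finset.mem_univ i))
      · exact Finset.card_le_univ _
  have := Real.rpow_le_rpow (by positivity) hle hp.le
  rwa [Real.mul_rpow hr (by positivity), ← Real.rpow_mul (by positivity), one_div_mul_cancel hp.ne',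
    Real.rpow_one] at this

theorem weakLp_rpow_le {ι : Type*} [Fintype ι] {p Z : ℝ} (hp : 0 < p) (hZ : 0 ≤ Z) {w : ι → ℝ}
    (h : ∀ r : ℝ, 0 < r → r ^ p * ((Finset.univ.filter fun i => r ≤ |w i|).card : ℝ) ≤ Z) :
    weakLp p w ^ p ≤ Z := by
  have hle : weakLp p w ≤ Z ^ p⁻¹ := by
    refine Real.sSup_le ?_ (by positivity)
    rintro z ⟨r, hr, rfl⟩
    rcases hr.eq_or_lt with rfl | hr
    · rw [zero_mul]; positivity
    rw [Real.le_rpow_inv_iff_of_pos (by positivity) hZ hp, Real.mul_rpow hr.le (by positivity),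
      ← Real.rpow_mul (by positivity), one_div_mul_cancel hp.ne', Real.rpow_one]
    convert h r hr
  rwa [Real.le_rpow_inv_iff_of_pos (weakLp_nonneg p w) hZ hp] at hle

theorem sum_biasedWeight_mul_weakLp_rpow_le {ι : Type*} [Fintype ι] [DecidableEq ι] {p q : ℝ}
    (hp : 0 < p) (h0 : 0 ≤ q) (h1 : q ≤ 1) (w : ι → ℝ) :
    ∑ B : ι → Bool, biasedWeight (fun _ => q) B * weakLp p (fun i => if B i then w i else 0) ^ p ≤
      6 * weakLp p w ^ p * √q := by
  have hpow {r : ℝ} (hr : 0 < r) : (r ^ p⁻¹) ^ p = r := Real.rpow_inv_rpow hr.le hp.ne'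
  obtain ⟨Z, hZ0, hZ, hsum⟩ := exists_majorant_selection h0 h1
    (Real.rpow_nonneg (weakLp_nonneg p w) p) (fun i => |w i| ^ p) (fun r hr => by
      have := rpow_mul_card_le_weakLp_rpow hp w (Real.rpow_nonneg hr.le p⁻¹)
      rw [hpow hr] at this
      simpa only [Real.rpow_inv_le_iff_of_pos hr.le (abs_nonneg _) hp] using this)
  refine le_trans (Finset.sum_le_sum fun B _ => ?_) hsum
  refine mul_le_mul_of_nonneg_left ?_ (biasedWeight_nonneg_s4 h0 h1 B)
  refine weakLp_rpow_le hp (hZ0 B) fun r hr => ?_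
  refine le_trans ?_ (hZ B (r ^ p) (by positivity))
  gcongr with i
  intro hi
  split_ifs at hi with hB
  · exact ⟨hB, Real.rpow_le_rpow hr.le hi hp.le⟩
  · rw [abs_zero] at hi
    linarith

theorem flipc_apply_self {ι : Type*} [DecidableEq ι] (x : ι → Bool) (i : ι) :
    flipc x i i = !(x i) := by simp [flipc]

theorem flipc_apply_of_ne {ι : Type*} [DecidableEq ι] (x : ι → Bool) {i j : ι} (h : j ≠ i) :
    flipc x i j = x j := by simp [flipc, h]

theorem flipc_flipc {ι : Type*} [DecidableEq ι] (x : ι → Bool) (i : ι) :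
    flipc (flipc x i) i = x := by simp [flipc]

theorem flipc_ne {ι : Type*} [DecidableEq ι] (x : ι → Bool) (i : ι) : flipc x i ≠ x := by
  intro h
  have := congrFun h i
  simp [flipc] at this

theorem sum_eq_zero_of_add_flipc {ι X : Type*} [Fintype ι] [DecidableEq ι] [AddCommMonoid X]
    (i : ι) (h : (ι → Bool) → X) (hh : ∀ x, h x + h (flipc x i) = 0) : ∑ x, h x = 0 :=
  Finset.sum_involution (fun x _ => flipc x i) (fun x _ => hh x) (fun x _ _ => flipc_ne x i)
    (fun _ _ => Finset.mem_univ _) (fun x _ => flipc_flipc x i)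

/-- Replace the coordinates of `x` selected by `B` by those of `w`. -/
def mix {ι : Type*} (B w x : ι → Bool) : ι → Bool := fun i => if B i then w i else x i

theorem sum_sum_mix {ι X : Type*} [Fintype ι] [DecidableEq ι] [AddCommMonoid X] (B : ι → Bool)
    (G : (ι → Bool) → (ι → Bool) → X) :
    ∑ x, ∑ w, G (mix B w x) (mix B x w) = ∑ x, ∑ w, G x w := by
  have hinv : Function.Involutive
      (fun z : (ι → Bool) × (ι → Bool) => (mix B z.2 z.1, mix B z.1 z.2)) := by
    rintro ⟨x, w⟩
    ext i <;> by_cases h : B i <;> simp [mix, h]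
  rw [← Fintype.sum_prod_type', ← Fintype.sum_prod_type']
  exact Equiv.sum_comp hinv.toPerm (fun z => G z.1 z.2)

/-- The discrete partial derivative in the direction `i`. -/
def cubeDeriv {ι X : Type*} [DecidableEq ι] [AddCommGroup X] [Module ℝ X] (f : (ι → Bool) → X)
    (i : ι) (x : ι → Bool) : X := (1 / 2 : ℝ) • (f x - f (flipc x i))

/-- The mean of `f` over the coordinates selected by `B`. -/
def resample {ι X : Type*} [Fintype ι] [DecidableEq ι] [AddCommGroup X] [Module ℝ X]
    (f : (ι → Bool) → X) (B x : ι → Bool) : X :=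
  (2 ^ Fintype.card ι : ℝ)⁻¹ • ∑ w, f (mix B w x)

theorem resample_sub_resample_flipc {ι X : Type*} [Fintype ι] [DecidableEq ι] [AddCommGroup X]
    [Module ℝ X] (f : (ι → Bool) → X) {B : ι → Bool} {i : ι} (hi : B i = true) (x : ι → Bool) :
    resample f B x - resample f (flipc B i) x =
      -((2 ^ Fintype.card ι : ℝ)⁻¹ •
        ∑ w, (sgn (x i) * sgn (w i)) • cubeDeriv f i (mix B w x)) := by
  rw [resample, resample, ← smul_sub, ← smul_neg, ← Finset.sum_sub_distrib]
  congr 1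
  rw [eq_neg_iff_add_eq_zero, ← Finset.sum_add_distrib]
  refine sum_eq_zero_of_add_flipc i _ fun w => ?_
  have e1 : mix B (flipc w i) x = flipc (mix B w x) i := by
    ext j
    rcases eq_or_ne j i with rfl | h
    · simp [mix, flipc, hi]
    · simp [mix, flipc, h]
  have e2 (w : ι → Bool) : mix (flipc B i) w x =
      if w i = x i then mix B w x else flipc (mix B w x) i := by
    ext j
    rcases eq_or_ne j i with rfl | h
    · split_ifs with h
      · simp [mix, flipc, hi, h]
      · simpa [mix, flipc, hi] using Bool.eq_not_of_ne (Ne.symm h)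
    · split_ifs <;> simp [mix, flipc, h]
  rw [e2, e2, e1, cubeDeriv, cubeDeriv, flipc_flipc, flipc_apply_self]
  cases hx : x i <;> cases hw : w i <;> simp [sgn] <;> module

theorem biasedWeight_eq_mul_prod_erase {ι : Type*} [Fintype ι] [DecidableEq ι] (q : ℝ)
    (B : ι → Bool) (i : ι) : biasedWeight (fun _ => q) B =
      (if B i then q else 1 - q) * ∏ j ∈ Finset.univ.erase i, (if B j then q else 1 - q) :=
  (Finset.mul_prod_erase _ (fun j => if B j then q else 1 - q) (Finset.mem_univ i)).symm

theorem sum_deriv_biasedWeight_smul {ι X : Type*} [Fintype ι] [DecidableEq ι] [AddCommGroup X]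
    [Module ℝ X] {q : ℝ} (hq : q ≠ 0) (G : (ι → Bool) → X) :
    ∑ B : ι → Bool, (∑ i, (∏ j ∈ Finset.univ.erase i, (if B j then q else 1 - q)) * sgn (B i)) •
        G B =
      q⁻¹ • ∑ B : ι → Bool, biasedWeight (fun _ => q) B •
        ∑ i, if B i then G B - G (flipc B i) else 0 := by
  rw [Finset.smul_sum]
  simp_rw [Finset.sum_smul, Finset.smul_sum]
  rw [Finset.sum_comm, Finset.sum_comm (s := Finset.univ (α := ι → Bool))]
  refine Finset.sum_congr rfl fun i _ => ?_
  rw [← sub_eq_zero, ← Finset.sum_sub_distrib]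
  refine sum_eq_zero_of_add_flipc i _ fun B => ?_
  have e : ∏ j ∈ Finset.univ.erase i, (if flipc B i j then q else 1 - q) =
      ∏ j ∈ Finset.univ.erase i, (if B j then q else 1 - q) :=
    Finset.prod_congr rfl fun j hj => by rw [flipc_apply_of_ne B (Finset.ne_of_mem_erase hj)]
  rw [biasedWeight_eq_mul_prod_erase q B i, biasedWeight_eq_mul_prod_erase q (flipc B i) i, e,
    flipc_flipc, flipc_apply_self]
  cases hB : B i <;> simp [sgn, smul_smul, hq] <;> module

theorem hasDerivAt_biasedWeight_s4 {ι : Type*} [Fintype ι] [DecidableEq ι] (B : ι → Bool) (q : ℝ) :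
    HasDerivAt (fun q => biasedWeight (fun _ => q) B)
      (∑ i, (∏ j ∈ Finset.univ.erase i, (if B j then q else 1 - q)) * sgn (B i)) q := by
  have h (i : ι) : HasDerivAt (fun q : ℝ => if B i then q else 1 - q) (sgn (B i)) q := by
    cases B i
    · simpa [sgn] using (hasDerivAt_id q).const_sub 1
    · simpa [sgn] using hasDerivAt_id' q
  simpa [biasedWeight] using HasDerivAt.fun_finsetProd (u := Finset.univ) fun i _ => h i

theorem norm_sum_smul_rpow_le {κ X : Type*} [NormedAddCommGroup X] [NormedSpace ℝ X] {p : ℝ}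
    (hp : 1 ≤ p) (s : Finset κ) (c : κ → ℝ) (hc : ∀ i ∈ s, 0 ≤ c i) (hc1 : ∑ i ∈ s, c i = 1)
    (v : κ → X) : ‖∑ i ∈ s, c i • v i‖ ^ p ≤ ∑ i ∈ s, c i * ‖v i‖ ^ p := by
  refine le_trans (Real.rpow_le_rpow (norm_nonneg _) ?_ (by linarith))
    (Real.rpow_arith_mean_le_arith_mean_rpow s c (fun i => ‖v i‖) hc hc1
      (fun _ _ => norm_nonneg _) hp)
  refine (norm_sum_le _ _).trans (Finset.sum_le_sum fun i hi => ?_)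
  rw [norm_smul, Real.norm_of_nonneg (hc i hi)]

theorem norm_cubeDeriv {ι X : Type*} [DecidableEq ι] [NormedAddCommGroup X] [NormedSpace ℝ X]
    (f : (ι → Bool) → X) (i : ι) (x : ι → Bool) :
    ‖cubeDeriv f i x‖ = (1 / 2) * dist (f x) (f (flipc x i)) := by
  rw [cubeDeriv, norm_smul, dist_eq_norm]
  norm_num

/-- The derivative in `q` of the mean of `f` after resampling each coordinate with
probability `q`. -/
theorem sum_deriv_biasedWeight_smul_resample {ι X : Type*} [Fintype ι] [DecidableEq ι]
    [AddCommGroup X] [Module ℝ X] {q : ℝ} (hq : q ≠ 0) (f : (ι → Bool) → X) (x : ι → Bool) :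
    ∑ B : ι → Bool, (∑ i, (∏ j ∈ Finset.univ.erase i, (if B j then q else 1 - q)) * sgn (B i)) •
        resample f B x =
      -(q⁻¹ • ∑ B : ι → Bool, biasedWeight (fun _ => q) B •
        ∑ w : ι → Bool, (2 ^ Fintype.card ι : ℝ)⁻¹ •
          ∑ i, (sgn (x i) * sgn (w i)) • if B i then cubeDeriv f i (mix B w x) else 0) := by
  rw [sum_deriv_biasedWeight_smul hq (fun B => resample f B x), ← smul_neg,
    ← Finset.sum_neg_distrib]
  congr 1
  refine Finset.sum_congr rfl fun B _ => ?_
  rw [← smul_neg]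
  congr 1
  rw [← Finset.smul_sum, Finset.sum_comm, Finset.smul_sum, ← Finset.sum_neg_distrib]
  refine Finset.sum_congr rfl fun i _ => ?_
  cases hB : B i
  · simp
  · simpa using resample_sub_resample_flipc f hB x

theorem sum_norm_deriv_rpow_le {X : Type*} [NormedAddCommGroup X] [NormedSpace ℝ X]
    {p C q : ℝ} (hp : 1 ≤ p) (hC : 0 ≤ C) (hq : 0 < q) (hq1 : q ≤ 1)
    (hX : ∀ (n : ℕ) (v : Fin n → X),
      (2 ^ n : ℝ)⁻¹ * ∑ x : Fin n → Bool, ‖∑ i, sgn (x i) • v i‖ ^ p ≤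
        C ^ p * weakLp p (fun i => ‖v i‖) ^ p)
    {n : ℕ} (f : (Fin n → Bool) → X) :
    ∑ x, ‖∑ B : Fin n → Bool,
        (∑ i, (∏ j ∈ Finset.univ.erase i, (if B j then q else 1 - q)) * sgn (B i)) •
          resample f B x‖ ^ p ≤
      q⁻¹ ^ p * √q * (6 * C ^ p *
        ∑ x, weakLp p (fun i => (1 / 2) * dist (f x) (f (flipc x i))) ^ p) := by
  have hp0 : 0 < p := by linarith
  set N : (Fin n → Bool) → (Fin n → Bool) → (Fin n → Bool) → ℝ := fun B x w =>
    ‖∑ i, sgn (w i) • if B i then sgn (x i) • cubeDeriv f i x else 0‖ ^ p with hN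
  have hmix (B x w : Fin n → Bool) :
      ‖∑ i, (sgn (x i) * sgn (w i)) • if B i then cubeDeriv f i (mix B w x) else 0‖ ^ p =
        N B (mix B w x) (mix B x w) := by
    simp only [hN]
    congr 2
    refine Finset.sum_congr rfl fun i _ => ?_
    cases hB : B i <;> simp [mix, hB, smul_smul]
  have hpoint (x : Fin n → Bool) : ‖∑ B : Fin n → Bool,
        (∑ i, (∏ j ∈ Finset.univ.erase i, (if B j then q else 1 - q)) * sgn (B i)) •
          resample f B x‖ ^ p ≤
      q⁻¹ ^ p * ∑ B : Fin n → Bool, biasedWeight (fun _ => q) B *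
        ∑ w, (2 ^ n : ℝ)⁻¹ * N B (mix B w x) (mix B x w) := by
    rw [sum_deriv_biasedWeight_smul_resample hq.ne', norm_neg, norm_smul,
      Real.mul_rpow (norm_nonneg _) (norm_nonneg _), Real.norm_of_nonneg (by positivity)]
    refine mul_le_mul_of_nonneg_left ?_ (by positivity)
    refine (norm_sum_smul_rpow_le hp _ _ (fun B _ => biasedWeight_nonneg_s4 hq.le hq1 B)
      (sum_biasedWeight_s4 q) _).trans (Finset.sum_le_sum fun B _ => ?_)
    refine mul_le_mul_of_nonneg_left ?_ (biasedWeight_nonneg_s4 hq.le hq1 B)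
    refine (norm_sum_smul_rpow_le hp _ _ (fun w _ => by positivity) (by simp) _).trans ?_
    simp_rw [hmix, Fintype.card_fin]
    rfl
  have hlin (B x : Fin n → Bool) : (2 ^ n : ℝ)⁻¹ * ∑ w, N B x w ≤ C ^ p *
      weakLp p (fun i => if B i then (1 / 2) * dist (f x) (f (flipc x i)) else 0) ^ p := by
    refine (hX n _).trans_eq ?_
    congr 3
    ext i
    have hs : ‖sgn (x i)‖ = 1 := by cases x i <;> simp [sgn]
    split_ifs
    · rw [norm_smul, hs, one_mul, norm_cubeDeriv]
    · exact norm_zero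
  calc _ ≤ ∑ x, q⁻¹ ^ p * ∑ B : Fin n → Bool, biasedWeight (fun _ => q) B *
        ∑ w, (2 ^ n : ℝ)⁻¹ * N B (mix B w x) (mix B x w) := Finset.sum_le_sum fun x _ => hpoint x
    _ = q⁻¹ ^ p * ∑ B : Fin n → Bool, biasedWeight (fun _ => q) B *
        ∑ x, (2 ^ n : ℝ)⁻¹ * ∑ w, N B x w := by
      rw [← Finset.mul_sum, Finset.sum_comm]
      simp_rw [← Finset.mul_sum, sum_sum_mix]
    _ ≤ q⁻¹ ^ p * ∑ B : Fin n → Bool, biasedWeight (fun _ => q) B * ∑ x, C ^ p *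
        weakLp p (fun i => if B i then (1 / 2) * dist (f x) (f (flipc x i)) else 0) ^ p := by
      refine mul_le_mul_of_nonneg_left (Finset.sum_le_sum fun B _ => ?_) (by positivity)
      exact mul_le_mul_of_nonneg_left (Finset.sum_le_sum fun x _ => hlin B x)
        (biasedWeight_nonneg_s4 hq.le hq1 B)
    _ = q⁻¹ ^ p * (C ^ p * ∑ x, ∑ B : Fin n → Bool, biasedWeight (fun _ => q) B *
        weakLp p (fun i => if B i then (1 / 2) * dist (f x) (f (flipc x i)) else 0) ^ p) := by
      rw [Finset.sum_comm]
      simp_rw [Finset.mul_sum, mul_left_comm (biasedWeight _ _)]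
    _ ≤ q⁻¹ ^ p * (C ^ p * ∑ x,
        6 * weakLp p (fun i => (1 / 2) * dist (f x) (f (flipc x i))) ^ p * √q) := by
      gcongr with x
      exact sum_biasedWeight_mul_weakLp_rpow_le hp0 hq.le hq1 _
    _ = _ := by
      rw [← Finset.sum_mul, ← Finset.mul_sum]
      ring

theorem norm_sub_le_of_norm_deriv_le_rpow {E : Type*} [NormedAddCommGroup E] [NormedSpace ℝ E]
    {F F' : ℝ → E} (hF : ∀ q, HasDerivAt F (F' q) q) {K θ : ℝ} (hK : 0 ≤ K) (hθ : 0 < θ)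
    (hbound : ∀ q, 0 < q → q ≤ 1 → ‖F' q‖ ≤ K * q ^ (θ - 1)) :
    ‖F 1 - F 0‖ ≤ K / θ := by
  have hcont : Continuous F := continuous_iff_continuousAt.2 fun q => (hF q).continuousAt
  have key {a : ℝ} (ha : 0 < a) (ha1 : a ≤ 1) : ‖F 1 - F a‖ ≤ K / θ := by
    have hd {q : ℝ} (hq : 0 < q) :
        HasDerivAt (fun q : ℝ => K / θ * (q ^ θ - a ^ θ)) (K * q ^ (θ - 1)) q := by
      refine (((Real.hasDerivAt_rpow_const (p := θ) (Or.inl hq.ne')).sub_const (a ^ θ)).const_mul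
        (K / θ)).congr_deriv ?_
      rw [← mul_assoc, div_mul_cancel₀ _ hθ.ne']
    have h := image_norm_le_of_norm_deriv_right_le_deriv_boundary' (a := a) (b := 1)
      (f := fun q => F q - F a) (f' := F')
      (hcont.sub continuous_const).continuousOn
      (fun q _ => ((hF q).sub_const (F a)).hasDerivWithinAt)
      (B := fun q : ℝ => K / θ * (q ^ θ - a ^ θ)) (by simp)
      (fun q hq => (hd (ha.trans_le hq.1)).continuousAt.continuousWithinAt)
      (fun q hq => (hd (ha.trans_le hq.1)).hasDerivWithinAt)
      (fun q hq => hbound q (ha.trans_le hq.1) hq.2.le) (Set.right_mem_Icc.2 ha1)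
    refine h.trans ?_
    rw [Real.one_rpow]
    refine mul_le_of_le_one_right (by positivity) ?_
    linarith [Real.rpow_nonneg ha.le θ]
  have ht : Filter.Tendsto (fun a => ‖F 1 - F a‖) (nhdsWithin 0 (Set.Ioi 0))
      (nhds ‖F 1 - F 0‖) :=
    ((continuous_const.sub hcont).norm.tendsto 0).mono_left nhdsWithin_le_nhds
  refine le_of_tendsto ht ?_
  filter_upwards [Ioc_mem_nhdsGT (zero_lt_one (α := ℝ))] with a ha using key ha.1 ha.2

theorem biasedWeight_zero {ι : Type*} [Fintype ι] [DecidableEq ι] (B : ι → Bool) :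
    biasedWeight (fun _ => 0) B = if B = fun _ => false then 1 else 0 := by
  split_ifs with h
  · simp [h, biasedWeight]
  · obtain ⟨i, hi⟩ := Function.ne_iff.1 h
    exact Finset.prod_eq_zero (Finset.mem_univ i) (by simpa using hi)

theorem biasedWeight_one {ι : Type*} [Fintype ι] [DecidableEq ι] (B : ι → Bool) :
    biasedWeight (fun _ => 1) B = if B = fun _ => true then 1 else 0 := by
  split_ifs with h
  · simp [h, biasedWeight]
  · obtain ⟨i, hi⟩ := Function.ne_iff.1 h
    exact Finset.prod_eq_zero (Finset.mem_univ i) (by simpa using hi)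

theorem negc_negc {ι : Type*} (x : ι → Bool) : negc (negc x) = x := by
  ext i
  simp [negc]

/-- The Poincaré inequality for functions on the cube, in terms of the weak `ℓ_p` norm of the
discrete gradient. -/
theorem norm_toLp_sub_mean_le {X : Type*} [NormedAddCommGroup X] [NormedSpace ℝ X]
    {p C : ℝ} [Fact (1 ≤ ENNReal.ofReal p)] (hp : 1 ≤ p) (hC : 0 ≤ C)
    (hX : ∀ (n : ℕ) (v : Fin n → X),
      (2 ^ n : ℝ)⁻¹ * ∑ x : Fin n → Bool, ‖∑ i, sgn (x i) • v i‖ ^ p ≤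
        C ^ p * weakLp p (fun i => ‖v i‖) ^ p)
    {n : ℕ} (f : (Fin n → Bool) → X) :
    ‖WithLp.toLp (ENNReal.ofReal p) (fun _ : Fin n → Bool => (2 ^ n : ℝ)⁻¹ • ∑ w, f w) -
        WithLp.toLp (ENNReal.ofReal p) f‖ ≤
      2 * p * (6 * C ^ p *
        ∑ x, weakLp p (fun i => (1 / 2) * dist (f x) (f (flipc x i))) ^ p) ^ (1 / p) := by
  have hp0 : 0 < p := by linarith
  have htoReal : (ENNReal.ofReal p).toReal = p := ENNReal.toReal_ofReal hp0.le
  set S := 6 * C ^ p * ∑ x, weakLp p (fun i => (1 / 2) * dist (f x) (f (flipc x i))) ^ p with hS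
  have hS0 : 0 ≤ S := mul_nonneg (by positivity)
    (Finset.sum_nonneg fun x _ => Real.rpow_nonneg (weakLp_nonneg _ _) _)
  have hder (q : ℝ) := HasDerivAt.fun_sum (u := (Finset.univ : Finset (Fin n → Bool)))
    fun B _ => (hasDerivAt_biasedWeight_s4 B q).smul_const
      (WithLp.toLp (ENNReal.ofReal p) (fun x : Fin n → Bool => resample f B x))
  have h := norm_sub_le_of_norm_deriv_le_rpow hder (K := S ^ (1 / p)) (θ := 1 / (2 * p))
    (by positivity) (by positivity) fun q hq hq1 => by
      rw [PiLp.norm_eq_sum (by rwa [htoReal]), htoReal]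
      have hle := sum_norm_deriv_rpow_le hp hC hq hq1 hX f
      rw [← hS] at hle
      have h1 : (q⁻¹ ^ p * √q * S) ^ (1 / p) = S ^ (1 / p) * q ^ (1 / (2 * p) - 1) := by
        rw [Real.mul_rpow (by positivity) hS0, mul_comm, Real.sqrt_eq_rpow,
          Real.inv_rpow hq.le, ← Real.rpow_neg hq.le, ← Real.rpow_add hq, ← Real.rpow_mul hq.le]
        congr 2
        field_simp
        ring
      rw [← h1]
      refine Real.rpow_le_rpow (by positivity) ?_ (by positivity)
      simpa using hle
  simp only [biasedWeight_zero, biasedWeight_one, ite_smul, one_smul, zero_smul,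
    Finset.sum_ite_eq', Finset.mem_univ, if_true] at h
  convert h using 1
  · have ht (w x : Fin n → Bool) : mix (fun _ => true) w x = w := by ext; simp [mix]
    have hf (w x : Fin n → Bool) : mix (fun _ => false) w x = x := by ext; simp [mix]
    have hmean (v : X) : (2 ^ n : ℝ)⁻¹ • ∑ _w : Fin n → Bool, v = v := by
      simp [← Nat.cast_smul_eq_nsmul ℝ, smul_smul]
    simp only [resample, ht, hf, Fintype.card_fin, hmean]
  · field_simp

/-- For `p ∈ (1,2)`, a Banach space satisfying the linear weak-`ℓ_p`
inequality with constant `C` has metric stable type `p` with constant `c_p · C`. -/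
theorem stmt4 (p : ℝ) (hp1 : 1 < p) (hp2 : p < 2) :
    ∃ c : ℝ, 0 < c ∧
      ∀ (X : Type) [NormedAddCommGroup X] [NormedSpace ℝ X] [CompleteSpace X],
      ∀ C : ℝ, 0 < C →
      (∀ (n : ℕ) (v : Fin n → X),
        (2 ^ n : ℝ)⁻¹ * ∑ x : Fin n → Bool, ‖∑ i, sgn (x i) • v i‖ ^ p ≤
          C ^ p * weakLp p (fun i => ‖v i‖) ^ p) →
      MetricStableType X p (c * C) := by
  have hp0 : 0 < p := by linarith
  refine ⟨4 * p * 6 ^ (1 / p), by positivity, ?_⟩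
  intro X _ _ _ C hC hX n f
  have : Fact (1 ≤ ENNReal.ofReal p) := ⟨by simpa using hp1.le⟩
  have htoReal : (ENNReal.ofReal p).toReal = p := ENNReal.toReal_ofReal hp0.le
  have h := norm_toLp_sub_mean_le hp1.le hC.le hX f
  set T := ∑ x, weakLp p (fun i => (1 / 2) * dist (f x) (f (flipc x i))) ^ p with hT
  have hT0 : 0 ≤ T := Finset.sum_nonneg fun x _ => Real.rpow_nonneg (weakLp_nonneg _ _) _
  set m := WithLp.toLp (ENNReal.ofReal p) (fun _ : Fin n → Bool => (2 ^ n : ℝ)⁻¹ • ∑ w, f w)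
    with hm
  set Φ := WithLp.toLp (ENNReal.ofReal p) f with hΦ
  set Ψ := WithLp.toLp (ENNReal.ofReal p) (fun x => f (negc x)) with hΨ
  have hneg : ‖m - Ψ‖ = ‖m - Φ‖ := by
    rw [PiLp.norm_eq_sum (by rwa [htoReal]), PiLp.norm_eq_sum (by rwa [htoReal])]
    congr 1
    exact Equiv.sum_comp (Function.Involutive.toPerm negc negc_negc)
      (fun x => ‖(m - Φ) x‖ ^ (ENNReal.ofReal p).toReal)
  have hdist : ‖Φ - Ψ‖ ≤ 4 * p * (6 * C ^ p * T) ^ (1 / p) := by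
    have e : Φ - Ψ = (m - Ψ) - (m - Φ) := by abel
    rw [e]
    refine (norm_sub_le _ _).trans ?_
    rw [hneg]
    linarith
  have hsum : ‖Φ - Ψ‖ ^ p = ∑ x : Fin n → Bool, dist (f x) (f (negc x)) ^ p := by
    rw [PiLp.norm_eq_sum (by rwa [htoReal]), htoReal, ← Real.rpow_mul (by positivity),
      one_div_mul_cancel hp0.ne', Real.rpow_one]
    simp [hΦ, hΨ, dist_eq_norm]
  have hfin := Real.rpow_le_rpow (norm_nonneg _) hdist hp0.le
  have hcancel {y : ℝ} (hy : 0 ≤ y) : (y ^ (1 / p)) ^ p = y := by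
    rw [← Real.rpow_mul hy, one_div_mul_cancel hp0.ne', Real.rpow_one]
  rw [hsum, Real.mul_rpow (by positivity) (by positivity), hcancel (by positivity)] at hfin
  rw [Real.mul_rpow (by positivity) hC.le, Real.mul_rpow (by positivity) (by positivity),
    hcancel (by positivity)]
  calc _ ≤ (2 ^ n : ℝ)⁻¹ * ((4 * p) ^ p * (6 * C ^ p * T)) := by gcongr
    _ = _ := by ring
end
end

section
/- Let X be a real Banach space and C, K ∈ (0,∞) be such that: (i) for every n ∈ ℕ and all v_1,…,v_n ∈ X, ∫_{{-1,1}^n} ‖Σ_{i=1}^n x_i v_i‖_X dσ_n(x) ≤ C · ‖(‖v_1‖_X,…,‖v_n‖_X)‖_{ℓ_{1,∞}^n}; and (ii) for every n ∈ ℕ and every f : {-1,1}^n → X, ∫_{{-1,1}^n} ‖f(x) − ∫_{{-1,1}^n} f dσ_n‖_X dσ_n(x) ≤ K · ∫_{{-1,1}^n} ∫_{{-1,1}^n} ‖Σ_{i=1}^n δ_i ∂_i f(x)‖_X dσ_n(δ) dσ_n(x), where ∂_i f(x) = (f(x) − f(x with i-th coordinate flipped))/2. Then X has metric stable type 1 with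 constant 2KC. -/
open Finset

noncomputable section

theorem negc_involutive {ι : Type*} : Function.Involutive (negc (ι := ι)) := fun x =>
  funext fun i => Bool.not_not (x i)

/-- A Banach space satisfying the linear weak-`ℓ_1` inequality with
constant `C` and the `L_1`-Pisier inequality with constant `K` has metric stable type `1`
with constant `2KC`. Here `∂_i f(x) = (f(x) - f(x with i-th coordinate flipped))/2`. -/
theorem stmt5 (X : Type) [NormedAddCommGroup X] [NormedSpace ℝ X] [CompleteSpace X]
    (C K : ℝ) (hC : 0 < C) (hK : 0 < K)
    (h1 : ∀ (n : ℕ) (v : Fin n → X),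
      (2 ^ n : ℝ)⁻¹ * ∑ x : Fin n → Bool, ‖∑ i, sgn (x i) • v i‖ ≤
        C * weakLp 1 (fun i => ‖v i‖))
    (h2 : ∀ (n : ℕ) (f : (Fin n → Bool) → X),
      (2 ^ n : ℝ)⁻¹ * ∑ x : Fin n → Bool,
          ‖f x - (2 ^ n : ℝ)⁻¹ • ∑ y : Fin n → Bool, f y‖ ≤
        K * ((2 ^ n : ℝ)⁻¹ * ∑ x : Fin n → Bool, (2 ^ n : ℝ)⁻¹ *
          ∑ δ : Fin n → Bool,
            ‖∑ i, sgn (δ i) • ((2 : ℝ)⁻¹ • (f x - f (flipc x i)))‖)) :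
    MetricStableType X 1 (2 * K * C) := by
  intro n f
  simp only [Real.rpow_one]
  let m : X := (2 ^ n : ℝ)⁻¹ • ∑ y : Fin n → Bool, f y
  have hanti : ∑ x : Fin n → Bool, ‖f (negc x) - m‖ = ∑ x : Fin n → Bool, ‖f x - m‖ :=
    Equiv.sum_comp (negc_involutive (ι := Fin n)).toPerm fun x => ‖f x - m‖
  have htri : ∑ x : Fin n → Bool, dist (f x) (f (negc x)) ≤
      2 * ∑ x : Fin n → Bool, ‖f x - m‖ := by
    calc ∑ x : Fin n → Bool, dist (f x) (f (negc x))
        ≤ ∑ x : Fin n → Bool, (‖f x - m‖ + ‖f (negc x) - m‖) := by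
          refine Finset.sum_le_sum fun x _ => ?_
          simpa only [dist_eq_norm] using dist_triangle_right (f x) (f (negc x)) m
      _ = 2 * ∑ x : Fin n → Bool, ‖f x - m‖ := by
          rw [Finset.sum_add_distrib, hanti, two_mul]
  have htype : ∀ x : Fin n → Bool,
      (2 ^ n : ℝ)⁻¹ * ∑ δ : Fin n → Bool,
          ‖∑ i, sgn (δ i) • ((2 : ℝ)⁻¹ • (f x - f (flipc x i)))‖ ≤
        C * weakLp 1 (fun i => (1 / 2) * dist (f x) (f (flipc x i))) := fun x => by
    simpa [norm_smul, dist_eq_norm] using h1 n fun i => (2 : ℝ)⁻¹ • (f x - f (flipc x i))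
  calc (2 ^ n : ℝ)⁻¹ * ∑ x : Fin n → Bool, dist (f x) (f (negc x))
      ≤ (2 ^ n : ℝ)⁻¹ * (2 * ∑ x : Fin n → Bool, ‖f x - m‖) := by gcongr
    _ = 2 * ((2 ^ n : ℝ)⁻¹ * ∑ x : Fin n → Bool, ‖f x - m‖) := by ring
    _ ≤ 2 * (K * ((2 ^ n : ℝ)⁻¹ * ∑ x : Fin n → Bool,
          C * weakLp 1 (fun i => (1 / 2) * dist (f x) (f (flipc x i))))) := by
        refine mul_le_mul_of_nonneg_left ((h2 n f).trans ?_) zero_le_two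
        exact mul_le_mul_of_nonneg_left (mul_le_mul_of_nonneg_left
          (Finset.sum_le_sum fun x _ => htype x) (by positivity)) hK.le
    _ = 2 * K * C * ((2 ^ n : ℝ)⁻¹ * ∑ x : Fin n → Bool,
          weakLp 1 (fun i => (1 / 2) * dist (f x) (f (flipc x i)))) := by
        rw [← Finset.mul_sum]
        ring
end
end

section
/- Fix t > 0 and α ∈ (0,1). Then: (a) for every x ∈ {-1,1} and every θ ∈ ℝ, p_t^α(x,1)·η_t^α(1,x;θ) + p_t^α(x,−1)·η_t^α(−1,x;θ) = 0; and (b) there exists θ ∈ ℝ such that for both x ∈ {-1,1}: p_t^α(x,1)·η_t^α(1,x;θ)^2 + p_t^α(x,−1)·η_t^α(−1,x;θ)^2 ≤ 1/(e^t − 1). -/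
open Finset

noncomputable section

theorem second_moment_le {s b : ℝ} (hs0 : 0 < s) (hs1 : s < 1) (hb0 : 0 < b) (hb1 : b < 1) :
    (1 - (1 - s) * b) * (s * b / (1 - (1 - s) * b)) ^ 2 +
      (1 - s) * b * (s * b / ((1 - s) * b)) ^ 2 ≤ s / (1 - s) := by
  have hu : 0 < 1 - s := by linarith
  have hp : s * b ≤ 1 - (1 - s) * b := by linarith
  have hp0 : 0 < 1 - (1 - s) * b := (mul_pos hs0 hb0).trans_le hp
  have key : (1 - (1 - s) * b) * (s * b / (1 - (1 - s) * b)) ^ 2 +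
      (1 - s) * b * (s * b / ((1 - s) * b)) ^ 2 =
        s / (1 - s) * (s * b / (1 - (1 - s) * b)) := by
    generalize hP : 1 - (1 - s) * b = P at hp0
    generalize hU : 1 - s = U at hu hP
    have hP' : P = 1 - U * b := hP.symm
    field_simp
    rw [hP']
    ring
  rw [key]
  exact mul_le_of_le_one_right (div_pos hs0 hu).le ((div_le_one hp0).2 hp)

/-- (a) The centering property of the matrix `η_t^α(·,·;θ)` and
(b) the existence of `θ` with a uniform second-moment bound `1/(e^t - 1)`. -/
theorem stmt7 (t α : ℝ) (ht : 0 < t) (hα0 : 0 < α) (hα1 : α < 1) :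
    (∀ (x : Bool) (θ : ℝ),
      ptrans t α x true * eta t α θ true x + ptrans t α x false * eta t α θ false x = 0) ∧
    (∃ θ : ℝ, ∀ x : Bool,
      ptrans t α x true * eta t α θ true x ^ 2 + ptrans t α x false * eta t α θ false x ^ 2 ≤
        1 / (Real.exp t - 1)) := by
  have hs0 : 0 < Real.exp (-t) := Real.exp_pos _
  have hs1 : Real.exp (-t) < 1 := Real.exp_lt_one_iff.2 (by linarith)
  have hrhs : 1 / (Real.exp t - 1) = Real.exp (-t) / (1 - Real.exp (-t)) := by
    have h1 : 0 < Real.exp t - 1 := by linarith [Real.one_lt_exp_iff.2 ht]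
    have h2 : 0 < 1 - Real.exp (-t) := by linarith
    have h3 : Real.exp (-t) * Real.exp t = 1 := by simp [← Real.exp_add]
    rw [div_eq_div_iff h1.ne' h2.ne']
    linear_combination -h3
  rw [hrhs]
  simp only [Bool.forall_bool, ptrans, eta]
  generalize Real.exp (-t) = s at hs0 hs1
  have hu : 0 < 1 - s := by linarith
  have pos : ∀ b : ℝ, 0 < b → b < 1 → 0 < (1 - s) * b ∧ 0 < 1 - (1 - s) * b :=
    fun b hb0 hb1 => ⟨mul_pos hu hb0, by nlinarith⟩
  obtain ⟨hα, hα'⟩ := pos α hα0 hα1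
  obtain ⟨hβ, hβ'⟩ := pos (1 - α) (by linarith) (by linarith)
  refine ⟨⟨fun θ => ?_, fun θ => ?_⟩, s * α, ?_, ?_⟩
  · rw [mul_div_cancel₀ _ hα.ne', mul_div_cancel₀ _ hα'.ne']
    ring
  · rw [mul_div_cancel₀ _ hβ.ne', mul_div_cancel₀ _ hβ'.ne']
    ring
  · have h := second_moment_le hs0 hs1 hα0 hα1
    rwa [neg_div, neg_sq, add_comm]
  · have h := second_moment_le hs0 hs1 (b := 1 - α) (by linarith) (by linarith)
    rw [show s - s * α = s * (1 - α) by ring, show s * α - s = -(s * (1 - α)) by ring,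
      neg_div, neg_sq]
    exact h
end
end

section
/- For all integers d, n with 1 ≤ d < n, there exists a continuous map h : 𝕊^d → 𝒞_d^n (where 𝕊^d is the unit sphere in ℝ^{d+1}) satisfying h(−x) = −h(x) for every x ∈ 𝕊^d. -/
open Finset

noncomputable section

/-- The value at `i` of the polynomial with coefficient vector `x`. -/
def momentCurvePairing {d n : ℕ} (x : EuclideanSpace ℝ (Fin (d + 1))) (i : Fin n) : ℝ :=
  ∑ j : Fin (d + 1), ((i : ℕ) : ℝ) ^ (j : ℕ) * x j

lemma continuous_momentCurvePairing {d n : ℕ} (i : Fin n) :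
    Continuous fun x : EuclideanSpace ℝ (Fin (d + 1)) => momentCurvePairing x i := by
  unfold momentCurvePairing
  fun_prop

lemma momentCurvePairing_neg {d n : ℕ} (x : EuclideanSpace ℝ (Fin (d + 1))) (i : Fin n) :
    momentCurvePairing (-x) i = -momentCurvePairing x i := by
  simp [momentCurvePairing]

/-- Any `d + 1` points of the moment curve in `ℝ^(d+1)` are linearly independent. -/
lemma eq_zero_of_momentCurvePairing_eq_zero {d n : ℕ} {x : EuclideanSpace ℝ (Fin (d + 1))}
    {S : Finset (Fin n)} (hS : S.card = d + 1) (h : ∀ i ∈ S, momentCurvePairing x i = 0) :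
    x = 0 := by
  have hinj : Function.Injective fun j : Fin (d + 1) =>
      (((S.orderEmbOfFin hS j : Fin n) : ℕ) : ℝ) :=
    Nat.cast_injective.comp (Fin.val_injective.comp (S.orderEmbOfFin hS).injective)
  have hx := Matrix.eq_zero_of_forall_index_sum_pow_mul_eq_zero hinj (v := fun j => x j)
    fun j => h _ (S.orderEmbOfFin_mem hS j)
  ext j
  exact congrFun hx j

/-- The least average of `|momentCurvePairing x i|` over `d + 1` distinct indices `i`. -/
def minAverage {d n : ℕ} (hdn : d < n) (x : EuclideanSpace ℝ (Fin (d + 1))) : ℝ :=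
  ((univ : Finset (Fin n)).powersetCard (d + 1)).inf'
    (powersetCard_nonempty.2 (by simpa using hdn))
    fun S => (∑ i ∈ S, |momentCurvePairing x i|) / (d + 1)

lemma continuous_minAverage {d n : ℕ} (hdn : d < n) : Continuous (minAverage hdn) := by
  refine Continuous.finset_inf'_apply _ fun S _ => ?_
  exact (continuous_finsetSum _ fun i _ => (continuous_momentCurvePairing i).abs).div_const _

lemma minAverage_neg {d n : ℕ} (hdn : d < n) (x : EuclideanSpace ℝ (Fin (d + 1))) :
    minAverage hdn (-x) = minAverage hdn x := by
  simp [minAverage, momentCurvePairing_neg]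

lemma minAverage_pos {d n : ℕ} (hdn : d < n) {x : EuclideanSpace ℝ (Fin (d + 1))} (hx : x ≠ 0) :
    0 < minAverage hdn x := by
  refine (lt_inf'_iff _).2 fun S hS => div_pos ?_ (by positivity)
  refine (sum_nonneg fun i _ => abs_nonneg _).lt_of_ne' fun h => hx ?_
  refine eq_zero_of_momentCurvePairing_eq_zero (mem_powersetCard.1 hS).2 fun i hi => ?_
  exact abs_eq_zero.1 ((sum_eq_zero_iff_of_nonneg fun i _ => abs_nonneg _).1 h i hi)

lemma card_filter_lt_minAverage_le {d n : ℕ} (hdn : d < n)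
    (x : EuclideanSpace ℝ (Fin (d + 1))) :
    (univ.filter fun i : Fin n => |momentCurvePairing x i| < minAverage hdn x).card ≤ d := by
  by_contra! hcard
  obtain ⟨S, hsub, hS⟩ := exists_subset_card_eq (Nat.succ_le_of_lt hcard)
  have hle : minAverage hdn x ≤ (∑ i ∈ S, |momentCurvePairing x i|) / (d + 1) :=
    inf'_le _ (mem_powersetCard.2 ⟨subset_univ S, hS⟩)
  have hlt : ∑ i ∈ S, |momentCurvePairing x i| < ∑ _i ∈ S, minAverage hdn x :=
    sum_lt_sum_of_nonempty (card_pos.1 (by omega)) fun i hi => (mem_filter.1 (hsub hi)).2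
  rw [sum_const, hS, nsmul_eq_mul] at hlt
  rw [le_div_iff₀ (by positivity)] at hle
  push_cast at hlt
  linarith

/-- The nearest-point projection of `ℝ` onto `[-1, 1]`. -/
def clampUnit (t : ℝ) : ℝ := max (-1) (min 1 t)

lemma continuous_clampUnit : Continuous clampUnit := by
  unfold clampUnit
  fun_prop

lemma clampUnit_neg (t : ℝ) : clampUnit (-t) = -clampUnit t := by
  unfold clampUnit
  grind

lemma abs_clampUnit_le (t : ℝ) : |clampUnit t| ≤ 1 := by
  unfold clampUnit
  grind

lemma abs_clampUnit_eq_one {t : ℝ} (ht : 1 ≤ |t|) : |clampUnit t| = 1 := by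
  unfold clampUnit
  grind

/-- There is a continuous odd map from the sphere `𝕊^d` into the
`d`-dimensional skeleton `𝒞_d^n` of the solid cube `[-1,1]^n`, provided `1 ≤ d < n`. -/
theorem stmt8 (d n : ℕ) (hd : 1 ≤ d) (hdn : d < n) :
    ∃ h : EuclideanSpace ℝ (Fin (d + 1)) → (Fin n → ℝ),
      ContinuousOn h (Metric.sphere (0 : EuclideanSpace ℝ (Fin (d + 1))) 1) ∧
      (∀ x ∈ Metric.sphere (0 : EuclideanSpace ℝ (Fin (d + 1))) 1,
        h x ∈ cubeSkeleton n d) ∧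
      (∀ x ∈ Metric.sphere (0 : EuclideanSpace ℝ (Fin (d + 1))) 1, h (-x) = -h x) := by
  refine ⟨fun x i => clampUnit (momentCurvePairing x i / minAverage hdn x), ?_, ?_, ?_⟩
  · refine continuousOn_pi.2 fun i => continuous_clampUnit.comp_continuousOn ?_
    refine (continuous_momentCurvePairing i).continuousOn.div
      (continuous_minAverage hdn).continuousOn fun x hx => ?_
    exact (minAverage_pos hdn (ne_zero_of_mem_unit_sphere ⟨x, hx⟩)).ne'
  · intro x hx
    have hpos := minAverage_pos hdn (ne_zero_of_mem_unit_sphere ⟨x, hx⟩)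
    refine ⟨fun i => abs_clampUnit_le _, ?_⟩
    have hcompl := card_filter_add_card_filter_not (s := (univ : Finset (Fin n)))
      fun i => |momentCurvePairing x i| < minAverage hdn x
    rw [card_univ, Fintype.card_fin] at hcompl
    have hcard := card_filter_lt_minAverage_le hdn x
    calc n - d ≤ (univ.filter fun i : Fin n =>
          ¬|momentCurvePairing x i| < minAverage hdn x).card := by omega
      _ ≤ _ := by
        rw [← Set.ncard_coe_finset]
        refine Set.ncard_le_ncard (fun i hi => abs_clampUnit_eq_one ?_) (Set.toFinite _)
        rw [abs_div, abs_of_pos hpos, one_le_div hpos]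
        exact not_lt.1 (mem_filter.1 hi).2
  · intro x _
    ext i
    simp only [momentCurvePairing_neg, minAverage_neg, neg_div, clampUnit_neg, Pi.neg_apply]
end
end
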